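/- arXiv:1304.7572 — 2 statements merged into one kernel-verified Lean document; each statement's English description precedes it below -/
import Mathlib

section
/- Left-induced combinatorial structures exist: if F: K → L is a colimit-preserving functor from a locally presentable category K to a combinatorial category L, then the class {f in K : Ff ∈ cof(L)} is a cofibrantly generated class on K; that is, it is closed under pushout, transfinite composition and retracts, and equals cof(S) for some set S of morphisms of K. -/
open CategoryTheory Category Limits Opposite

universe w v u u' u''

namespace CellularPaper

variable {K : Type u} [Category.{v} K]

/-- The restriction of a chain `F : J ⥤ K` to the elements below `j`. -/
def restrictionLT {J : Type w} [Preorder J] (F : J ⥤ K) (j : J) :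
    {i : J // i < j} ⥤ K :=
  (Monotone.functor (f := fun i : {i : J // i < j} => (i : J)) fun _ _ h => h) ⋙ F

/-- The cocone on the restriction of `F` below `j` with apex `F.obj j`. -/
@[simps]
def coconeLT {J : Type w} [Preorder J] (F : J ⥤ K) (j : J) :
    Cocone (restrictionLT F j) where
  pt := F.obj j
  ι :=
    { app := fun i => F.map (homOfLE i.2.le)
      naturality := fun i i' h => by
        dsimp [restrictionLT, Monotone.functor]
        rw [← F.map_comp]
        simp }

/-- `f` is a transfinite composite of a smooth chain with links in `C`. -/
def IsTransfiniteCompositionOf (C : MorphismProperty K) : MorphismProperty K :=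
  fun A B f =>
    ∃ (J : Type w) (_ : LinearOrder J) (_ : SuccOrder J) (_ : OrderBot J)
      (_ : WellFoundedLT J) (F : J ⥤ K) (c : Cocone F) (_ : IsColimit c)
      (eA : A ≅ F.obj ⊥) (eB : c.pt ≅ B),
      (∀ j : J, ¬IsMax j → C (F.map (homOfLE (Order.le_succ j)))) ∧
      (∀ j : J, Order.IsSuccLimit j → Nonempty (IsColimit (coconeLT F j))) ∧
      eA.hom ≫ c.ι.app ⊥ ≫ eB.hom = f

/-- A cellular structure: a class of morphisms containing all isomorphisms and closed
under pushout and transfinite composition. -/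
structure IsCellular (C : MorphismProperty K) : Prop where
  isos : ∀ {A B : K} (f : A ⟶ B), IsIso f → C f
  pushout : ∀ {A B A' B' : K} {f : A ⟶ B} {u : A ⟶ A'} {v : B ⟶ B'} {g : A' ⟶ B'},
    IsPushout f u v g → C f → C g
  transfinite : ∀ {A B : K} (f : A ⟶ B), IsTransfiniteCompositionOf.{v} C f → C f

/-- `f` is a retract of `g` in the arrow category. -/
def IsRetractOf {A B X Y : K} (f : A ⟶ B) (g : X ⟶ Y) : Prop :=
  ∃ (u : A ⟶ X) (v : B ⟶ Y) (r : X ⟶ A) (s : Y ⟶ B),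
    u ≫ g = f ≫ v ∧ r ≫ f = g ≫ s ∧ u ≫ r = 𝟙 A ∧ v ≫ s = 𝟙 B

/-- The class of retracts of morphisms in `C`. -/
def retracts (C : MorphismProperty K) : MorphismProperty K :=
  fun _ _ f => ∃ (X Y : K) (g : X ⟶ Y), C g ∧ IsRetractOf f g

/-- The class of pushouts of morphisms in `C`. -/
def Po (C : MorphismProperty K) : MorphismProperty K :=
  fun A' B' g => ∃ (A B : K) (f : A ⟶ B) (u : A ⟶ A') (v : B ⟶ B'),
    C f ∧ IsPushout f u v g

/-- A κ-directed preorder. -/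
def IsCardinalDirected (P : Type v) [Preorder P] (κ : Cardinal.{v}) : Prop :=
  ∀ S : Set P, Cardinal.mk S < κ → ∃ p : P, ∀ s ∈ S, s ≤ p

/-- A κ-presentable object: its hom-functor preserves κ-directed colimits. -/
def IsCardinalPresentable (κ : Cardinal.{v}) (A : K) : Prop :=
  ∀ (P : Type v) (_ : Preorder P), IsCardinalDirected P κ →
    Nonempty (PreservesColimitsOfShape P (coyoneda.obj (op A)))

/-- A locally κ-presentable category. -/
structure IsLocallyPresentable (κ : Cardinal.{v}) (K : Type u) [Category.{v} K] : Prop where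
  regular : κ.IsRegular
  hasColimits : HasColimits K
  generators : ∃ (ι : Type v) (G : ι → K), (∀ i, IsCardinalPresentable κ (G i)) ∧
    ∀ X : K, ∃ (P : Type v) (_ : Preorder P) (F : P ⥤ K) (c : Cocone F) (_ : IsColimit c),
      IsCardinalDirected P κ ∧ Nonempty (c.pt ≅ X) ∧ ∀ p : P, ∃ i, Nonempty (F.obj p ≅ G i)

/-- A locally presentable category. -/
def LocallyPresentable (K : Type u) [Category.{v} K] : Prop :=
  ∃ κ : Cardinal.{v}, IsLocallyPresentable κ K

/-- The smallest cellular class containing `X`. -/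
def cellClosure (X : MorphismProperty K) : MorphismProperty K :=
  fun _ _ f => ∀ C : MorphismProperty K, IsCellular C → X ≤ C → C f

/-- `cof(X)`: retracts of transfinite composites of pushouts of `X`. -/
def cofClosure (X : MorphismProperty K) : MorphismProperty K :=
  retracts (IsTransfiniteCompositionOf.{v} (Po X))

/-- The morphism property generated by a family of morphisms. -/
def ofFamily {ι : Type*} {a b : ι → K} (s : ∀ i, a i ⟶ b i) : MorphismProperty K :=
  fun _ _ f => ∃ i, Nonempty (Arrow.mk f ≅ Arrow.mk (s i))

/-- `C` is cofibrantly generated by a set of morphisms. -/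
def IsCofibrantlyGenerated (C : MorphismProperty K) : Prop :=
  ∃ (ι : Type v) (a b : ι → K) (s : ∀ i, a i ⟶ b i),
    C = cofClosure (ofFamily s)

/-- A combinatorial structure on a locally presentable category. -/
structure IsCombinatorial (K : Type u) [Category.{v} K] (C : MorphismProperty K) : Prop where
  locallyPresentable : LocallyPresentable K
  cellular : IsCellular C
  retractClosed : retracts C ≤ C
  cofibrantlyGenerated : IsCofibrantlyGenerated C

/-- `f` is a transfinite composite of length `< κ` of morphisms in `C`. -/
def IsBoundedTransfiniteCompositionOf (κ : Cardinal.{v}) (C : MorphismProperty K) :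
    MorphismProperty K :=
  fun A B f =>
    ∃ (J : Type v) (_ : LinearOrder J) (_ : SuccOrder J) (_ : OrderBot J)
      (_ : WellFoundedLT J), Cardinal.mk J < κ ∧
      ∃ (F : J ⥤ K) (c : Cocone F) (_ : IsColimit c)
        (eA : A ≅ F.obj ⊥) (eB : c.pt ≅ B),
        (∀ j : J, ¬IsMax j → C (F.map (homOfLE (Order.le_succ j)))) ∧
        (∀ j : J, Order.IsSuccLimit j → Nonempty (IsColimit (coconeLT F j))) ∧
        eA.hom ≫ c.ι.app ⊥ ≫ eB.hom = f

/-- The morphisms of `C` with κ-presentable domain and codomain. -/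
def betweenPresentable (κ : Cardinal.{v}) (C : MorphismProperty K) : MorphismProperty K :=
  fun A B f => C f ∧ IsCardinalPresentable κ A ∧ IsCardinalPresentable κ B

/-- `Po_κ(X)`: pushouts of morphisms of `X` between κ-presentable objects. -/
def PoCard (κ : Cardinal.{v}) (X : MorphismProperty K) : MorphismProperty K :=
  betweenPresentable κ (Po X)

/-- The category `psh(K²)`: objects are morphisms of `K`, morphisms are pushout squares. -/
structure PshArrow (K : Type u) [Category.{v} K] : Type max u v where
  arr : Arrow K

instance : Category.{v} (PshArrow K) where
  Hom g f := {φ : g.arr ⟶ f.arr // IsPushout g.arr.hom φ.left φ.right f.arr.hom}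
  id g := ⟨𝟙 _, IsPushout.of_vert_isIso ⟨by simp⟩⟩
  comp φ ψ := ⟨φ.1 ≫ ψ.1, φ.2.paste_vert ψ.2⟩
  id_comp φ := Subtype.ext (Category.id_comp _)
  comp_id φ := Subtype.ext (Category.comp_id _)
  assoc _ _ _ := Subtype.ext (Category.assoc _ _ _)


section PsPull

variable {K : Type u} {L : Type u'} {M : Type u''}
variable [Category.{v} K] [Category.{v} L] [Category.{v} M]

/-- The pseudopullback of `F : K ⥤ M` and `G : L ⥤ M`. -/
structure PsPull (F : K ⥤ M) (G : L ⥤ M) : Type max u u' v where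
  k : K
  l : L
  t : F.obj k ≅ G.obj l

variable {F : K ⥤ M} {G : L ⥤ M}

/-- Morphisms in the pseudopullback. -/
@[ext]
structure PsHom (a b : PsPull F G) : Type v where
  hk : a.k ⟶ b.k
  hl : a.l ⟶ b.l
  w : F.map hk ≫ b.t.hom = a.t.hom ≫ G.map hl

instance : Category.{v} (PsPull F G) where
  Hom := PsHom
  id a := ⟨𝟙 _, 𝟙 _, by simp⟩
  comp f g := ⟨f.hk ≫ g.hk, f.hl ≫ g.hl, by
    rw [F.map_comp, G.map_comp, Category.assoc, g.w, ← Category.assoc, f.w,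
      Category.assoc]⟩

/-- The first projection of the pseudopullback. -/
def projK (F : K ⥤ M) (G : L ⥤ M) : PsPull F G ⥤ K where
  obj a := a.k
  map f := f.hk

/-- The second projection of the pseudopullback. -/
def projL (F : K ⥤ M) (G : L ⥤ M) : PsPull F G ⥤ L where
  obj a := a.l
  map f := f.hl

/-- `Ps(C, D)`: morphisms of the pseudopullback whose projections lie in `C` and `D`. -/
def PsClass (C : MorphismProperty K) (D : MorphismProperty L) :
    MorphismProperty (PsPull F G) :=
  fun _ _ f => C f.hk ∧ D f.hl

end PsPull

end CellularPaper

namespace LeftInduced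

section FunctorCategory

variable {I : Type*} [Category I] {C : Type u} [Category.{v} C]
  [∀ i j : I, HasCoproductsOfShape (i ⟶ j) C]

lemma isCardinalPresentable_evaluationLeftAdjoint_obj [HasColimitsOfSize.{v, v} C]
    (κ : Cardinal.{v}) [Fact κ.IsRegular] (i : I) (X : C) [IsCardinalPresentable X κ] :
    IsCardinalPresentable ((evaluationLeftAdjoint C i).obj X) κ :=
  have : ((evaluation I C).obj i).IsCardinalAccessible κ := ⟨fun _ _ _ => inferInstance⟩
  (evaluationAdjunctionRight C i).isCardinalPresentable_leftAdjoint_obj κ X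

lemma isStrongGenerator_evaluationLeftAdjoint {P : ObjectProperty C} (hP : P.IsStrongGenerator) :
    (ObjectProperty.ofObj (fun T : I × Subtype P =>
      (evaluationLeftAdjoint C T.1).obj T.2.1)).IsStrongGenerator := by
  rw [ObjectProperty.isStrongGenerator_iff] at hP ⊢
  obtain ⟨hP₁, hP₂⟩ := hP
  refine ⟨fun X Y f g h => ?_, fun X Y i _ hi => ?_⟩
  · ext j
    refine hP₁ _ _ fun G hG a => ?_
    have := h _ (ObjectProperty.ofObj_apply _ (⟨j, G, hG⟩ : I × Subtype P))
      (((evaluationAdjunctionRight C j).homEquiv G X).symm a)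
    simpa [Adjunction.homEquiv_naturality_right] using
      congr_arg ((evaluationAdjunctionRight C j).homEquiv G Y) this
  · rw [NatTrans.isIso_iff_isIso_app]
    intro j
    have := (NatTrans.mono_iff_mono_app' C i).1 inferInstance j
    refine hP₂ _ fun G hG a => ?_
    obtain ⟨b, hb⟩ := hi _ (ObjectProperty.ofObj_apply _ (⟨j, G, hG⟩ : I × Subtype P))
      (((evaluationAdjunctionRight C j).homEquiv G Y).symm a)
    refine ⟨(evaluationAdjunctionRight C j).homEquiv G X b, ?_⟩
    have := congr_arg ((evaluationAdjunctionRight C j).homEquiv G Y) hb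
    simpa [Adjunction.homEquiv_naturality_right] using this

end FunctorCategory

lemma isCardinalLocallyPresentable_composableArrows {C : Type u} [Category.{v} C] (n : ℕ)
    (κ : Cardinal.{v}) [Fact κ.IsRegular] [IsCardinalLocallyPresentable C κ] :
    IsCardinalLocallyPresentable (ComposableArrows C n) κ := by
  obtain ⟨P, _, hP₁, hP₂⟩ :=
    (IsCardinalLocallyPresentable.iff_exists_isStrongGenerator C κ).1 inferInstance
  rw [IsCardinalLocallyPresentable.iff_exists_isStrongGenerator]
  refine ⟨_, inferInstance, isStrongGenerator_evaluationLeftAdjoint (I := Fin (n + 1)) hP₁, ?_⟩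
  rintro _ ⟨X, G, hG⟩
  have : IsCardinalPresentable G κ := hP₂ _ hG
  exact isCardinalPresentable_evaluationLeftAdjoint_obj κ X G

/-- Presentability in the sense of directed colimits agrees with `IsCardinalPresentable`. -/
lemma isCardinalPresentable_of_directed {C : Type u} [Category.{v} C] {κ : Cardinal.{v}}
    [Fact κ.IsRegular] {X : C} (hX : CellularPaper.IsCardinalPresentable κ X) :
    IsCardinalPresentable X κ where
  preservesColimitOfShape J _ _ := by
    obtain ⟨α, _, _, G, _⟩ := IsCardinalFiltered.exists_cardinal_directed J κ
    obtain ⟨_⟩ := hX α inferInstance fun S hS => by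
      have hS' : HasCardinalLT S κ := by rwa [hasCardinalLT_iff_cardinal_mk_lt]
      exact ⟨IsCardinalFiltered.max (fun s : S => (s : α)) hS',
        fun s hs => leOfHom (IsCardinalFiltered.toMax (fun s : S => (s : α)) hS' ⟨s, hs⟩)⟩
    exact Functor.Final.preservesColimitsOfShape_of_final G _

lemma isCardinalFiltered_of_directed {P : Type v} [Preorder P] {κ : Cardinal.{v}}
    [Fact κ.IsRegular] (hP : CellularPaper.IsCardinalDirected P κ) :
    IsCardinalFiltered P κ :=
  isCardinalFiltered_preorder _ _ fun ι s hι => by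
    obtain ⟨p, hp⟩ := hP (Set.range s) (Cardinal.mk_range_le.trans_lt hι)
    exact ⟨p, fun k => hp _ ⟨k, rfl⟩⟩

lemma isCardinalLocallyPresentable_of_isLocallyPresentable {C : Type u} [Category.{v} C]
    {κ : Cardinal.{v}} [Fact κ.IsRegular] (h : CellularPaper.IsLocallyPresentable κ C) :
    IsCardinalLocallyPresentable C κ := by
  have := h.hasColimits
  obtain ⟨ι, G, hG, hX⟩ := h.generators
  have hP : (ObjectProperty.ofObj G).IsCardinalFilteredGenerator κ :=
    ObjectProperty.IsCardinalFilteredGenerator.isoClosure_iff.1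
    { le_isCardinalPresentable := by
        rintro X ⟨_, ⟨i⟩, ⟨e⟩⟩
        have := isCardinalPresentable_of_directed (hG i)
        exact isCardinalPresentable_of_iso e.symm κ
      exists_colimitsOfShape X := by
        obtain ⟨P, _, D, c, hc, hP, ⟨e⟩, hD⟩ := hX X
        refine ⟨P, inferInstance, isCardinalFiltered_of_directed hP,
          ⟨{ diag := D
             ι := c.ι ≫ (Functor.const _).map e.hom
             isColimit := IsColimit.ofIsoColimit hc (Cocone.ext e)
             prop_diag_obj := fun p => ?_ }⟩⟩
        obtain ⟨i, ⟨e'⟩⟩ := hD p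
        exact ⟨_, ⟨i⟩, ⟨e'⟩⟩ }
  have := hP.hasCardinalFilteredGenerator
  constructor

section Res

variable {P : Type*} [Preorder P] {C : Type*} [Category C]

/-- The action of a diagram indexed by a preorder on an inequality. -/
def res (X : P ⥤ C) {p q : P} (h : p ≤ q) : X.obj p ⟶ X.obj q := X.map (homOfLE h)

lemma map_eq_res (X : P ⥤ C) {p q : P} (f : p ⟶ q) : X.map f = res X (leOfHom f) := rfl

@[simp]
lemma res_refl (X : P ⥤ C) {p : P} (h : p ≤ p) : res X h = 𝟙 _ := X.map_id p

@[simp]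
lemma res_comp (X : P ⥤ C) {p q r : P} (h : p ≤ q) (h' : q ≤ r) :
    res X h ≫ res X h' = res X (h.trans h') := (X.map_comp _ _).symm

@[simp]
lemma res_comp_assoc (X : P ⥤ C) {p q r : P} (h : p ≤ q) (h' : q ≤ r) {Z : C}
    (f : X.obj r ⟶ Z) : res X h ≫ res X h' ≫ f = res X (h.trans h') ≫ f := by
  rw [← assoc, res_comp]

lemma res_naturality {X Y : P ⥤ C} (η : X ⟶ Y) {p q : P} (h : p ≤ q) :
    res X h ≫ η.app q = η.app p ≫ res Y h := η.naturality _

lemma res_naturality_assoc {X Y : P ⥤ C} (η : X ⟶ Y) {p q : P} (h : p ≤ q) {Z : C}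
    (f : Y.obj q ⟶ Z) : res X h ≫ η.app q ≫ f = η.app p ≫ res Y h ≫ f := by
  rw [← assoc, res_naturality, assoc]

/-- The cocone on `φ ⋙ X` given by an upper bound of `φ`. -/
@[simps]
def boundCocone (X : P ⥤ C) {I : Type*} [Category I] (φ : I ⥤ P) (p : P)
    (h : ∀ i, φ.obj i ≤ p) : Cocone (φ ⋙ X) where
  pt := X.obj p
  ι :=
    { app i := res X (h i)
      naturality i j f := by simp [map_eq_res] }

/-- A natural transformation between diagrams indexed by a preorder. -/
@[simps]
def mkNatTrans {X Y : P ⥤ C} (a : ∀ p, X.obj p ⟶ Y.obj p)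
    (ha : ∀ p q (h : p ≤ q), res X h ≫ a q = a p ≫ res Y h) : X ⟶ Y where
  app := a
  naturality p q f := ha p q (leOfHom f)

/-- A cocone on a diagram indexed by a preorder. -/
@[simps]
def mkCocone {X : P ⥤ C} {Z : C} (a : ∀ p, X.obj p ⟶ Z)
    (ha : ∀ p q (h : p ≤ q), res X h ≫ a q = a p) : Cocone X where
  pt := Z
  ι :=
    { app := a
      naturality p q f := (ha p q (leOfHom f)).trans (comp_id _).symm }

lemma nonempty_isColimit {J : Type*} [Category J] {X : J ⥤ C} {c : Cocone X}
    (h₁ : ∀ (Z : C) (a b : c.pt ⟶ Z), (∀ j, c.ι.app j ≫ a = c.ι.app j ≫ b) → a = b)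
    (h₂ : ∀ s : Cocone X, ∃ a : c.pt ⟶ s.pt, ∀ j, c.ι.app j ≫ a = s.ι.app j) :
    Nonempty (IsColimit c) := by
  choose d hd using h₂
  exact ⟨{ desc := d
           fac := hd
           uniq := fun s m hm => h₁ _ _ _ fun j => (hm j).trans (hd s j).symm }⟩

lemma isPushout_of_exists {W X Y Z : C} {f : W ⟶ X} {g : W ⟶ Y} {i : X ⟶ Z} {j : Y ⟶ Z}
    (w : f ≫ i = g ≫ j)
    (h₁ : ∀ (T : C) (a b : Z ⟶ T), i ≫ a = i ≫ b → j ≫ a = j ≫ b → a = b)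
    (h₂ : ∀ (T : C) (a : X ⟶ T) (b : Y ⟶ T), f ≫ a = g ≫ b →
      ∃ c : Z ⟶ T, i ≫ c = a ∧ j ≫ c = b) : IsPushout f g i j := by
  have (s : PushoutCocone f g) := h₂ s.pt s.inl s.inr s.condition
  choose d hd using this
  exact ⟨⟨w⟩, ⟨PushoutCocone.IsColimit.mk _ d (fun s => (hd s).1) (fun s => (hd s).2)
    fun s m hm₁ hm₂ => h₁ _ _ _ (hm₁.trans (hd s).1.symm) (hm₂.trans (hd s).2.symm)⟩⟩

end Res

section Good

variable {R : Type w} [PartialOrder R] {C : Type u} [Category.{v} C]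

lemma iic_le {r : R} {T : LowerSet R} (h : r ∈ T) : LowerSet.Iic r ≤ T := LowerSet.Iic_le.2 h

lemma iic_mono {r r' : R} (h : r ≤ r') : LowerSet.Iic r ≤ LowerSet.Iic r' :=
  iic_le (LowerSet.mem_Iic_iff.2 h)

/-- The embedding of a poset in its lower sets. -/
abbrev iic (R : Type w) [PartialOrder R] : R ⥤ LowerSet R :=
  Monotone.functor (f := LowerSet.Iic) fun _ _ h => iic_mono h

/-- The restriction of `iic` to a lower set. -/
abbrev iicOn (T : LowerSet R) : T ⥤ LowerSet R :=
  Monotone.functor (f := fun r : T => LowerSet.Iic (r : R)) fun _ _ h => iic_mono h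

/-- A diagram on lower sets is good if its value at `T` is the colimit of its values
at the principal lower sets contained in `T`. -/
def IsGood (X : LowerSet R ⥤ C) : Prop :=
  ∀ T : LowerSet R, Nonempty (IsColimit (boundCocone X (iicOn T) T fun r => iic_le r.2))

variable {X : LowerSet R ⥤ C}

lemma IsGood.hom_ext (hX : IsGood X) {T : LowerSet R} {Z : C} {a b : X.obj T ⟶ Z}
    (h : ∀ r (hr : r ∈ T), res X (iic_le hr) ≫ a = res X (iic_le hr) ≫ b) :
    a = b :=
  (hX T).some.hom_ext fun r => h r.1 r.2

lemma IsGood.exists_desc (hX : IsGood X) {T : LowerSet R} {Z : C}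
    (φ : ∀ r ∈ T, X.obj (LowerSet.Iic r) ⟶ Z)
    (hφ : ∀ r r' (h : r ≤ r') (hr' : r' ∈ T),
      res X (iic_mono h) ≫ φ r' hr' = φ r (T.lower h hr')) :
    ∃ a : X.obj T ⟶ Z, ∀ r (hr : r ∈ T), res X (iic_le hr) ≫ a = φ r hr := by
  let s : Cocone (iicOn T ⋙ X) :=
    mkCocone (fun r => φ r.1 r.2) fun r r' h => hφ r.1 r'.1 h r'.2
  exact ⟨(hX T).some.desc s, fun r hr => (hX T).some.fac s ⟨r, hr⟩⟩

lemma isGood_of_exists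
    (h₁ : ∀ (T : LowerSet R) (Z : C) (a b : X.obj T ⟶ Z), (∀ r (hr : r ∈ T),
      res X (iic_le hr) ≫ a = res X (iic_le hr) ≫ b) → a = b)
    (h₂ : ∀ (T : LowerSet R) (Z : C) (φ : ∀ r ∈ T, X.obj (LowerSet.Iic r) ⟶ Z),
      (∀ r r' (h : r ≤ r') (hr' : r' ∈ T),
        res X (iic_mono h) ≫ φ r' hr' = φ r (T.lower h hr')) →
      ∃ a : X.obj T ⟶ Z, ∀ r (hr : r ∈ T), res X (iic_le hr) ≫ a = φ r hr) :
    IsGood X := fun T =>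
  nonempty_isColimit (fun Z a b h => h₁ _ _ _ _ fun r hr => h ⟨r, hr⟩) fun s => by
    obtain ⟨a, ha⟩ := h₂ T s.pt (fun r hr => s.ι.app ⟨r, hr⟩)
      fun r r' h hr' => s.w (homOfLE h : (⟨r, T.lower h hr'⟩ : T) ⟶ ⟨r', hr'⟩)
    exact ⟨a, fun r => ha r.1 r.2⟩

lemma IsGood.comp (hX : IsGood X) {D : Type*} [Category D] (F : C ⥤ D)
    [∀ T : LowerSet R, PreservesColimitsOfShape T F] : IsGood (X ⋙ F) := fun T =>
  ⟨IsColimit.ofIsoColimit (isColimitOfPreserves F (hX T).some)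
    (Cocone.ext (Iso.refl _) fun _ => comp_id _)⟩

lemma IsGood.natTrans_ext (hX : IsGood X) {Y : LowerSet R ⥤ C} {a b : X ⟶ Y}
    (h : ∀ r : R, a.app (LowerSet.Iic r) = b.app (LowerSet.Iic r)) : a = b := by
  ext T
  exact hX.hom_ext fun r hr => by rw [res_naturality, res_naturality, h]

lemma IsGood.exists_natTrans (hX : IsGood X) (Y : LowerSet R ⥤ C)
    (φ : ∀ r : R, X.obj (LowerSet.Iic r) ⟶ Y.obj (LowerSet.Iic r))
    (hφ : ∀ r r' (h : r ≤ r'), res X (iic_mono h) ≫ φ r' = φ r ≫ res Y (iic_mono h)) :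
    ∃ ψ : X ⟶ Y, ∀ r : R, ψ.app (LowerSet.Iic r) = φ r := by
  have h (T : LowerSet R) := hX.exists_desc (T := T) (Z := Y.obj T)
    (fun r hr => φ r ≫ res Y (iic_le hr))
    (fun r r' h hr' => by rw [← assoc, hφ r r' h, assoc, res_comp])
  choose a ha using h
  refine ⟨mkNatTrans a fun T T' h => hX.hom_ext fun r hr => ?_, fun r => ?_⟩
  · rw [res_comp_assoc, ha T' r (h hr), ← assoc, ha T r hr, assoc, res_comp]
  · simpa using ha (LowerSet.Iic r) r (LowerSet.mem_Iic_iff.2 le_rfl)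

lemma exists_isGood [HasColimitsOfSize.{w, w} C] (X : R ⥤ C) :
    ∃ X' : LowerSet R ⥤ C, IsGood X' ∧ Nonempty (iic R ⋙ X' ≅ X) := by
  have : (iic R).Full := ⟨fun f => ⟨homOfLE (LowerSet.mem_Iic_iff.1 (LowerSet.Iic_le.1
    (leOfHom f))), rfl⟩⟩
  have : (iic R).Faithful := ⟨fun _ => Subsingleton.elim _ _⟩
  obtain ⟨X', α, hX', hα⟩ : ∃ (X' : LowerSet R ⥤ C) (α : X ⟶ iic R ⋙ X')
      (_ : (Functor.LeftExtension.mk X' α).IsPointwiseLeftKanExtension), IsIso α :=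
    ⟨_, (iic R).pointwiseLeftKanExtensionUnit X,
      (iic R).pointwiseLeftKanExtensionIsPointwiseLeftKanExtension X,
      ((iic R).pointwiseLeftKanExtensionIsPointwiseLeftKanExtension X).isIso_hom⟩
  refine ⟨X', isGood_of_exists (fun T Z a b h => ?_) fun T Z φ hφ => ?_, ⟨(asIso α).symm⟩⟩
  · refine (hX' T).hom_ext fun g => ?_
    have := h g.left (LowerSet.Iic_le.1 (leOfHom g.hom))
    have := congr_arg (α.app g.left ≫ ·) this
    exact (assoc _ _ _).trans (this.trans (assoc _ _ _).symm)
  · have hs (g g' : CostructuredArrow (iic R) T) (f : g ⟶ g') :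
        X.map f.left ≫ α.app g'.left ≫ φ g'.left (LowerSet.Iic_le.1 (leOfHom g'.hom)) =
          α.app g.left ≫ φ g.left (LowerSet.Iic_le.1 (leOfHom g.hom)) := by
      exact (assoc _ _ _).symm.trans ((congrArg (· ≫ _) (α.naturality f.left)).trans
        ((assoc _ _ _).trans (congrArg (α.app g.left ≫ ·)
          (hφ g.left g'.left (leOfHom f.left) (LowerSet.Iic_le.1 (leOfHom g'.hom))))))
    let s : Cocone (CostructuredArrow.proj (iic R) T ⋙ X) :=
      { pt := Z
        ι := { app g := α.app g.left ≫ φ g.left (LowerSet.Iic_le.1 (leOfHom g.hom))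
               naturality g g' f := (hs g g' f).trans (comp_id _).symm } }
    refine ⟨(hX' T).desc s, fun r hr => ?_⟩
    have := (hX' T).fac s (CostructuredArrow.mk (homOfLE (iic_le hr) : (iic R).obj r ⟶ T))
    exact (cancel_epi (α.app r)).1 ((assoc _ _ _).symm.trans this)

lemma IsGood.isPushout (hX : IsGood X) (T D : LowerSet R) :
    IsPushout (res X (inf_le_left : T ⊓ D ≤ T)) (res X (inf_le_right : T ⊓ D ≤ D))
      (res X (le_sup_left : T ≤ T ⊔ D)) (res X (le_sup_right : D ≤ T ⊔ D)) := by
  classical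
  refine isPushout_of_exists (by simp) (fun Z a b h h' => ?_) fun Z a b h => ?_
  · refine hX.hom_ext fun r hr => ?_
    obtain hr | hr := hr
    · simpa using congr_arg (res X (iic_le hr) ≫ ·) h
    · simpa using congr_arg (res X (iic_le hr) ≫ ·) h'
  · have hab {r : R} (hr : r ∈ T) (hr' : r ∈ D) :
        res X (iic_le hr) ≫ a = res X (iic_le hr') ≫ b := by
      simpa using congr_arg (res X (iic_le (show r ∈ T ⊓ D from ⟨hr, hr'⟩)) ≫ ·) h
    obtain ⟨c, hc⟩ := hX.exists_desc (T := T ⊔ D)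
      (fun r hr => if h : r ∈ T then res X (iic_le h) ≫ a
        else res X (iic_le (hr.resolve_left h)) ≫ b)
      (fun r r' h hr' => by
        by_cases hT' : r' ∈ T
        · have hT : r ∈ T := T.lower h hT'
          simp [hT', hT]
        · by_cases hT : r ∈ T
          · simp [hT', hT, hab hT (D.lower h (hr'.resolve_left hT'))]
          · simp [hT', hT])
    refine ⟨c, hX.hom_ext fun r hr => ?_, hX.hom_ext fun r hr => ?_⟩
    · simpa [hr] using hc r (Or.inl hr)
    · by_cases hT : r ∈ T
      · simpa [hT, hab hT hr] using hc r (Or.inr hr)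
      · simpa [hT] using hc r (Or.inr hr)

lemma IsGood.isColimit_of_directed (hX : IsGood X) {I : Type*} [Preorder I] [IsDirectedOrder I]
    (φ : I ⥤ LowerSet R) (T : LowerSet R) (h : ∀ i, φ.obj i ≤ T)
    (hT : ∀ r ∈ T, ∃ i, r ∈ φ.obj i) : Nonempty (IsColimit (boundCocone X φ T h)) := by
  have h₁ (Z : C) (a b : X.obj T ⟶ Z) (hab : ∀ i, res X (h i) ≫ a = res X (h i) ≫ b) :
      a = b := hX.hom_ext fun r hr => by
    obtain ⟨i, hi⟩ := hT r hr
    simpa using congr_arg (res X (iic_le hi) ≫ ·) (hab i)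
  refine nonempty_isColimit h₁ fun s => ?_
  · have hs {i j : I} (hij : i ≤ j) : res X (leOfHom (φ.map (homOfLE hij))) ≫ s.ι.app j =
        s.ι.app i := s.w (homOfLE hij)
    have key {r : R} {i j : I} (hi : r ∈ φ.obj i) (hj : r ∈ φ.obj j) :
        res X (iic_le hi) ≫ s.ι.app i = res X (iic_le hj) ≫ s.ι.app j := by
      obtain ⟨k, hik, hjk⟩ := exists_ge_ge i j
      rw [← hs hik, ← hs hjk, res_comp_assoc, res_comp_assoc]
    choose i hi using hT
    obtain ⟨a, ha⟩ := hX.exists_desc (fun r hr => res X (iic_le (hi r hr)) ≫ s.ι.app (i r hr))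
      (fun r r' h hr' => by
        rw [res_comp_assoc, key (hi r (T.lower h hr')) ((φ.obj _).lower h (hi r' hr'))])
    refine ⟨a, fun j => hX.hom_ext fun r hr => ?_⟩
    have := ha r (h j hr)
    rw [key (hi r (h j hr)) hr] at this
    exact (res_comp_assoc X _ (h j) a).trans this

end Good

section Chain

variable {C : Type u} [Category.{v} C]

lemma le_of_isColimit {G : Type w} [Preorder G] {I : Type*} [Category I] {φ : I ⥤ G}
    {c : Cocone φ} (hc : IsColimit c) {q : G} (h : ∀ i, φ.obj i ≤ q) : c.pt ≤ q :=
  leOfHom (hc.desc (boundCocone (𝟭 G) φ q h))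

lemma preservesColimitsOfShape_of_lub {G : Type w} [PartialOrder G] (Φ : G ⥤ C) {I : Type u'}
    [Category.{u''} I]
    (h : ∀ φ : I ⥤ G, ∃ (p : G) (h : ∀ i, φ.obj i ≤ p), (∀ q, (∀ i, φ.obj i ≤ q) → p ≤ q) ∧
      Nonempty (IsColimit (boundCocone Φ φ p h))) :
    HasColimitsOfShape I G ∧ PreservesColimitsOfShape I Φ := by
  refine ⟨⟨fun φ => ?_⟩, ⟨fun {φ} => ⟨fun {c} hc => ?_⟩⟩⟩
  · obtain ⟨p, h, hp, -⟩ := h φ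
    exact ⟨⟨⟨boundCocone (𝟭 G) φ p h,
      { desc := fun s => homOfLE (hp _ fun i => leOfHom (s.ι.app i))
        fac := fun _ _ => Subsingleton.elim _ _
        uniq := fun _ _ _ => Subsingleton.elim _ _ }⟩⟩⟩
  · obtain ⟨p, h, hp, ⟨hc'⟩⟩ := h φ
    obtain rfl : p = c.pt :=
      le_antisymm (hp _ fun i => leOfHom (c.ι.app i)) (le_of_isColimit hc h)
    exact ⟨hc'⟩

lemma exists_transfiniteCompositions {G : Type w} [PartialOrder G] (Φ : G ⥤ C)
    (W : MorphismProperty C) (x₀ : G) (next : G → G) (hnext : ∀ x, x ≤ next x)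
    (hW : ∀ x, W (res Φ (hnext x)))
    (hlub : ∀ (I : Type w) [LinearOrder I] [Nonempty I] (φ : I ⥤ G),
      ∃ (p : G) (h : ∀ i, φ.obj i ≤ p), (∀ q, (∀ i, φ.obj i ≤ q) → p ≤ q) ∧
        Nonempty (IsColimit (boundCocone Φ φ p h))) :
    ∃ (x : G) (h : x₀ ≤ x), next x = x ∧ W.transfiniteCompositions.{w} (res Φ h) := by
  let κ : Cardinal.{w} := Order.succ (max Cardinal.aleph0 (Cardinal.mk G))
  let J := κ.ord.ToType
  have hκ : Cardinal.aleph0 ≤ κ := (le_max_left _ _).trans (Order.le_succ _)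
  have : NoMaxOrder J := Cardinal.noMaxOrder hκ
  have : Nonempty J := by
    rw [← Cardinal.mk_ne_zero_iff, Cardinal.mk_toType, Cardinal.card_ord]
    exact (Cardinal.aleph0_pos.trans_le hκ).ne'
  let : OrderBot J := WellFoundedLT.toOrderBot J
  let : SuccOrder J := SuccOrder.ofLinearWellFoundedLT J
  have hI (I : Type w) [LinearOrder I] [Nonempty I] :=
    preservesColimitsOfShape_of_lub Φ (hlub I)
  have hne (j : J) (hj : Order.IsSuccLimit j) : Nonempty (Set.Iio j) :=
    ⟨⟨⊥, hj.bot_lt⟩⟩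
  have : HasIterationOfShape J G :=
    { hasColimitsOfShape_of_isSuccLimit := fun j hj => by
        have := hne j hj
        exact (hI _).1
      hasColimitsOfShape := (hI J).1 }
  have : PreservesColimitsOfShape J Φ := (hI J).2
  have : PreservesWellOrderContinuousOfShape J Φ :=
    ⟨fun j hj => by
      have := hne j hj
      exact (hI _).2⟩
  let S : SmallObject.SuccStruct G := ⟨x₀, next, fun x => homOfLE (hnext x)⟩
  let t := S.transfiniteCompositionOfShapeιIteration J
  have hsucc (j : J) : S.succ (t.F.obj j) = t.F.obj (Order.succ j) :=
    (t.map_mem j (not_isMax j)).succ_eq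
  obtain ⟨j, hj⟩ : ∃ j, next (t.F.obj j) = t.F.obj j := by
    by_contra! h
    have : StrictMono t.F.obj := by
      intro i j hij
      refine lt_of_lt_of_le ?_ (leOfHom (t.F.map (homOfLE (Order.succ_le_of_lt hij))))
      rw [← hsucc]
      exact lt_of_le_of_ne (hnext _) (h i).symm
    have := Cardinal.mk_le_of_injective this.injective
    rw [Cardinal.mk_toType, Cardinal.card_ord] at this
    exact (Order.lt_succ _).not_ge (this.trans (le_max_right _ _))
  have hle {i : J} (hij : i ≤ j) : t.F.obj i ≤ t.F.obj j := leOfHom (t.F.map (homOfLE hij))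
  have hmax (i : J) : t.F.obj i ≤ t.F.obj j := by
    induction i using SuccOrder.limitRecOn with
    | isMin i hi => exact hle (hi.eq_bot ▸ bot_le)
    | succ i hi ih =>
      obtain h | h := le_or_gt j i
      · have : t.F.obj i = t.F.obj j := le_antisymm ih (leOfHom (t.F.map (homOfLE h)))
        rw [← hsucc, this]
        exact hj.le
      · exact hle (Order.succ_le_of_lt h)
    | isSuccLimit i hi ih =>
      exact le_of_isColimit (t.F.isColimitOfIsWellOrderContinuous i hi) fun k => ih k.1 k.2
  have hx : S.iteration J = t.F.obj j :=
    le_antisymm (le_of_isColimit t.isColimit hmax) (leOfHom (t.incl.app j))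
  let t' : (W.inverseImage Φ).TransfiniteCompositionOfShape J (S.ιIteration J) :=
    t.ofLE fun _ _ f hf => by
      cases hf
      exact hW _
  refine ⟨S.iteration J, leOfHom (S.ιIteration J), by rw [hx, hj], ?_⟩
  exact MorphismProperty.transfiniteCompositionsOfShape_le_transfiniteCompositions _ J _
    ⟨t'.map⟩

end Chain

section Cof

variable {C : Type u} [Category.{v} C]

lemma isTransfiniteCompositionOf_eq (W : MorphismProperty C) :
    CellularPaper.IsTransfiniteCompositionOf.{w} W = W.transfiniteCompositions.{w} := by
  ext A B f
  rw [MorphismProperty.transfiniteCompositions_iff]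
  constructor
  · rintro ⟨J, _, _, _, _, F, c, hc, eA, eB, h₁, h₂, h₃⟩
    exact ⟨J, _, _, _, _, ⟨
      { F := F
        isoBot := eA.symm
        isWellOrderContinuous := ⟨fun m hm => h₂ m hm⟩
        incl := c.ι ≫ (Functor.const _).map eB.hom
        isColimit := IsColimit.ofIsoColimit hc (Cocone.ext eB)
        fac := h₃
        map_mem := h₁ }⟩⟩
  · rintro ⟨J, _, _, _, _, ⟨t⟩⟩
    exact ⟨J, inferInstance, inferInstance, inferInstance, inferInstance, t.F, _,
      t.isColimit, t.isoBot.symm, Iso.refl _, t.map_mem,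
      fun j hj => t.isWellOrderContinuous.nonempty_isColimit j hj, by simp⟩

lemma po_eq (W : MorphismProperty C) : CellularPaper.Po W = W.pushouts := by
  ext A B f
  constructor
  · rintro ⟨A', B', g, u, v, hg, h⟩
    exact ⟨A', B', g, u, v, hg, h.flip⟩
  · rintro ⟨A', B', g, u, v, hg, h⟩
    exact ⟨A', B', g, u, v, hg, h.flip⟩

lemma retracts_eq (W : MorphismProperty C) : CellularPaper.retracts W = W.retracts := by
  ext A B f
  constructor
  · rintro ⟨X, Y, g, hg, u, v, r, s, h₁, h₂, h₃, h₄⟩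
    exact ⟨X, Y, g,
      { i := Arrow.homMk u v h₁
        r := Arrow.homMk r s h₂
        retract := by ext <;> assumption }, hg⟩
  · rintro ⟨X, Y, g, h, hg⟩
    exact ⟨X, Y, g, hg, h.i.left, h.i.right, h.r.left, h.r.right, h.i.w, h.r.w,
      h.left.retract, h.right.retract⟩

lemma cofClosure_eq (W : MorphismProperty C) :
    CellularPaper.cofClosure W = (W.pushouts.transfiniteCompositions.{v}).retracts := by
  rw [CellularPaper.cofClosure, retracts_eq, isTransfiniteCompositionOf_eq, po_eq]

lemma ofFamily_eq {ι : Type*} {a b : ι → C} (s : ∀ i, a i ⟶ b i) :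
    CellularPaper.ofFamily s = (MorphismProperty.ofHoms s).isoClosure := by
  ext A B f
  constructor
  · rintro ⟨i, ⟨e⟩⟩
    exact ⟨_, _, _, ⟨i⟩, ⟨e.symm⟩⟩
  · rintro ⟨_, _, _, ⟨i⟩, ⟨e⟩⟩
    exact ⟨i, ⟨e.symm⟩⟩

lemma isStableUnderCoproducts [HasColimitsOfSize.{w, w} C] (W : MorphismProperty C)
    [W.RespectsIso] [W.ContainsIdentities] [W.IsStableUnderCobaseChange]
    [MorphismProperty.IsStableUnderTransfiniteComposition.{w} W] :
    MorphismProperty.IsStableUnderCoproducts.{w} W where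
  isStableUnderCoproductsOfShape I := by
    refine MorphismProperty.IsStableUnderCoproductsOfShape.mk _ _ fun A B _ _ f hf => ?_
    have (T : Set I) : ∃ (P : C) (a : ∐ A ⟶ P) (b : ∀ i ∈ T, B i ⟶ P),
        (∀ i hi, f i ≫ b i hi = Sigma.ι A i ≫ a) ∧
        (∀ (Z : C) (x y : P ⟶ Z), a ≫ x = a ≫ y → (∀ i hi, b i hi ≫ x = b i hi ≫ y) → x = y) ∧
        (∀ (Z : C) (x : ∐ A ⟶ Z) (y : ∀ i ∈ T, B i ⟶ Z),
          (∀ i hi, f i ≫ y i hi = Sigma.ι A i ≫ x) →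
          ∃ z : P ⟶ Z, a ≫ z = x ∧ ∀ i hi, b i hi ≫ z = y i hi) := by
      let p : ∐ (fun i : T => A i) ⟶ ∐ A := Sigma.desc fun i : T => Sigma.ι A i
      let q : ∐ (fun i : T => A i) ⟶ ∐ (fun i : T => B i) := Limits.Sigma.map fun i : T => f i
      refine ⟨pushout p q, pushout.inl p q,
        fun i hi => Sigma.ι (fun i : T => B i) ⟨i, hi⟩ ≫ pushout.inr p q, fun i hi => ?_,
        fun Z x y h h' => ?_, fun Z x y h => ?_⟩
      · have := Sigma.ι (fun i : T => A i) ⟨i, hi⟩ ≫= pushout.condition (f := p) (g := q)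
        simpa [p, q] using this.symm
      · refine pushout.hom_ext h (Sigma.hom_ext _ _ fun i => ?_)
        simpa using h' i.1 i.2
      · have e : p ≫ x = q ≫ Sigma.desc fun i : T => y i.1 i.2 :=
          Sigma.hom_ext _ _ fun i => by simp [p, q, h]
        refine ⟨pushout.desc x _ e, pushout.inl_desc _ _ _, fun i hi => ?_⟩
        rw [assoc, pushout.inr_desc]
        exact Sigma.ι_desc _ (⟨i, hi⟩ : T)
    choose P a b hab hext hdesc using this
    have (T T' : Set I) (h : T ≤ T') := hdesc T (P T') (a T') (fun i hi => b T' i (h hi))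
      (fun i hi => hab _ _ _)
    choose m hm₁ hm₂ using this
    let Φ : Set I ⥤ C :=
      { obj := P
        map := fun g => m _ _ (leOfHom g)
        map_id := fun T => hext _ _ _ _ (by simp [hm₁]) (by simp [hm₂])
        map_comp := fun g g' => hext _ _ _ _ (by simp [← assoc, hm₁]) (by simp [← assoc, hm₂]) }
    have hΦ₁ {T T'} (h : T ≤ T') : a T ≫ res Φ h = a T' := hm₁ _ _ h
    have hΦ₂ {T T'} (h : T ≤ T') (i) (hi : i ∈ T) : b T i hi ≫ res Φ h = b T' i (h hi) :=
      hm₂ _ _ h i hi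
    have step (T : Set I) : ∃ (T' : Set I) (h : T ≤ T'), (T' = T → T = Set.univ) ∧ W (res Φ h) := by
      by_cases hT : T = Set.univ
      · exact ⟨T, le_rfl, fun _ => hT, by simpa using W.id_mem _⟩
      · obtain ⟨i, hi⟩ := (Set.ne_univ_iff_exists_notMem T).1 hT
        refine ⟨insert i T, Set.subset_insert i T,
          fun h => (hi (h ▸ Set.mem_insert i T)).elim, ?_⟩
        have hi' (j) (hj : j ∈ insert i T) (hj' : j ∉ T) : j = i := hj.resolve_right hj'
        refine MorphismProperty.of_isPushout (f := f i) (g := Sigma.ι A i ≫ a T)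
          (f' := res Φ (Set.subset_insert i T)) (g' := b (insert i T) i (Set.mem_insert i T))
          ?_ (hf i)
        refine isPushout_of_exists (by rw [hab, assoc, hΦ₁]) (fun Z x y h h' => ?_)
          fun Z x y h => ?_
        · refine hext _ _ _ _ ?_ fun j hj => ?_
          · rw [← hΦ₁ (Set.subset_insert i T), assoc, assoc, h]
          · by_cases hj' : j ∈ T
            · rw [← hΦ₂ (Set.subset_insert i T) j hj', assoc, assoc, h]
            · obtain rfl := hi' j hj hj'
              exact h'
        · have (j) (hj : j ∈ insert i T) : ∃ z : B j ⟶ Z, f j ≫ z = Sigma.ι A j ≫ a T ≫ x ∧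
              (∀ hj' : j ∈ T, z = b T j hj' ≫ x) ∧ ∀ e : j = i, z = eqToHom (by rw [e]) ≫ y := by
            by_cases hj' : j ∈ T
            · refine ⟨b T j hj' ≫ x, by rw [← assoc, hab, assoc], fun _ => rfl, ?_⟩
              rintro rfl
              exact (hi hj').elim
            · obtain rfl := hi' j hj hj'
              exact ⟨y, by rw [← h, assoc], fun h => (hj' h).elim, by simp⟩
          choose z hz₁ hz₂ hz₃ using this
          obtain ⟨t, ht₁, ht₂⟩ := hdesc (insert i T) Z (a T ≫ x) z hz₁
          refine ⟨t, hext _ _ _ _ (by rw [← assoc, hΦ₁, ht₁]) fun j hj => ?_, ?_⟩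
          · rw [← assoc, hΦ₂, ht₂, hz₂ _ _ hj]
          · rw [ht₂, hz₃ _ _ rfl, eqToHom_refl, id_comp]
    choose next hnext hnext' hW using step
    obtain ⟨T, hT, hT', hT''⟩ := exists_transfiniteCompositions Φ W ∅ next hnext hW
      fun J _ _ φ => by
        have hφ {j j' : J} (h : j ≤ j') : φ.obj j ⊆ φ.obj j' := leOfHom (φ.map (homOfLE h))
        refine ⟨⋃ j, φ.obj j, fun j => Set.subset_iUnion _ j, fun q => Set.iUnion_subset, ?_⟩
        have hmem {i : I} (hi : i ∈ ⋃ j, φ.obj j) : ∃ j, i ∈ φ.obj j := Set.mem_iUnion.1 hi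
        choose k hk using @hmem
        have h₁ (Z : C) (x y : P (⋃ j, φ.obj j) ⟶ Z)
            (h : ∀ j, res Φ (Set.subset_iUnion φ.obj j) ≫ x =
              res Φ (Set.subset_iUnion φ.obj j) ≫ y) : x = y := by
          refine hext _ _ _ _ ?_ fun i hi => ?_
          · have j := Classical.arbitrary J
            rw [← hΦ₁ (Set.subset_iUnion φ.obj j), assoc, assoc, h]
          · rw [← hΦ₂ (Set.subset_iUnion φ.obj (k hi)) i (hk hi), assoc, assoc, h]
        refine nonempty_isColimit h₁ fun s => ?_
        let c (j) : P (φ.obj j) ⟶ s.pt := s.ι.app j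
        have hc {j j' : J} (h : j ≤ j') : res Φ (hφ h) ≫ c j' = c j := s.w (homOfLE h)
        have hca (j j' : J) : a (φ.obj j) ≫ c j = a (φ.obj j') ≫ c j' := by
          obtain ⟨l, hl, hl'⟩ := exists_ge_ge j j'
          rw [← hc hl, ← hc hl', ← assoc, ← assoc, hΦ₁, hΦ₁]
        have hcb (i) (j j' : J) (hi : i ∈ φ.obj j) (hi' : i ∈ φ.obj j') :
            b _ i hi ≫ c j = b _ i hi' ≫ c j' := by
          obtain ⟨l, hl, hl'⟩ := exists_ge_ge j j'
          rw [← hc hl, ← hc hl', ← assoc, ← assoc, hΦ₂, hΦ₂]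
        obtain ⟨t, ht₁, ht₂⟩ := hdesc (⋃ j, φ.obj j) s.pt
          (a (φ.obj (Classical.arbitrary J)) ≫ c _) (fun i hi => b _ i (hk hi) ≫ c _)
          fun i hi => by rw [← assoc, hab, assoc, hca]
        refine ⟨t, fun j => ?_⟩
        change res Φ (Set.subset_iUnion φ.obj j) ≫ t = c j
        refine hext _ _ _ _ ?_ fun i hi => ?_
        · rw [← assoc, hΦ₁, ht₁, hca]
        · rw [← assoc, hΦ₂, ht₂, hcb]
    obtain rfl := hnext' T hT'
    have hW' := MorphismProperty.transfiniteCompositions_le _ _ hT''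
    obtain ⟨z₀, hz₀, -⟩ := hdesc ∅ _ (𝟙 _) (fun i hi => hi.elim) fun i hi => hi.elim
    obtain ⟨z₁, hz₁, hz₁'⟩ := hdesc Set.univ _ (Limits.Sigma.map f) (fun i _ => Sigma.ι B i)
      fun i hi => by simp
    let e₀ : P ∅ ≅ ∐ A :=
      { hom := z₀
        inv := a ∅
        hom_inv_id := hext _ _ _ _ (by rw [← assoc, hz₀, id_comp, comp_id]) fun i hi => hi.elim
        inv_hom_id := hz₀ }
    let e₁ : P Set.univ ≅ ∐ B :=
      { hom := z₁
        inv := Sigma.desc fun i => b Set.univ i (Set.mem_univ i)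
        hom_inv_id := hext _ _ _ _
          (by
            rw [← assoc, hz₁, comp_id]
            exact Sigma.hom_ext _ _ fun i => by simp [hab])
          fun i hi => by simp [← assoc, hz₁']
        inv_hom_id := Sigma.hom_ext _ _ fun i => by simp [hz₁'] }
    refine (W.arrow_mk_iso_iff (Arrow.isoMk e₀ e₁ ?_)).1 hW'
    refine hext _ _ _ _ ?_ fun i hi => hi.elim
    change a ∅ ≫ z₀ ≫ Limits.Sigma.map f = a ∅ ≫ res Φ hT ≫ z₁
    rw [← assoc, hz₀, id_comp, ← assoc, hΦ₁, hz₁]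

lemma exists_regular_ge {ι : Type w} (c : ι → Cardinal.{w}) :
    ∃ κ : Cardinal.{w}, κ.IsRegular ∧ ∀ i, c i ≤ κ := by
  obtain ⟨κ, hκ, h⟩ := HasCardinalLT.exists_regular_cardinal_forall.{w} fun i => (c i).out
  exact ⟨κ, hκ, fun i => le_of_lt (by simpa [hasCardinalLT_iff_cardinal_mk_lt] using h i)⟩

lemma exists_isCardinalPresentable_forall [IsAccessibleCategory.{w} C] {ι : Type w} (a : ι → C)
    (μ : Cardinal.{w}) :
    ∃ (κ : Cardinal.{w}) (_ : Fact κ.IsRegular), μ ≤ κ ∧ ∀ i, IsCardinalPresentable (a i) κ := by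
  have (i : ι) : ∃ (κ : Cardinal.{w}) (_ : Fact κ.IsRegular), IsCardinalPresentable (a i) κ :=
    Functor.IsAccessible.exists_cardinal
  choose c hc hc' using this
  obtain ⟨κ, hκ, h⟩ := exists_regular_ge (fun i : Option ι => i.elim μ c)
  have : Fact κ.IsRegular := ⟨hκ⟩
  exact ⟨κ, this, h none, fun i => isCardinalPresentable_of_le (κ := c i) (a i) (h (some i))⟩

lemma hasSmallObjectArgument_ofHoms [LocallySmall.{w} C] [HasColimitsOfSize.{w, w} C]
    {ι : Type w} {a b : ι → C} (s : ∀ i, a i ⟶ b i) (κ : Cardinal.{w}) [Fact κ.IsRegular]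
    (ha : ∀ i, IsCardinalPresentable (a i) κ) :
    MorphismProperty.HasSmallObjectArgument.{w} (MorphismProperty.ofHoms s) := by
  have : Nonempty κ.ord.ToType := by simpa using (Fact.out : κ.IsRegular).ne_zero
  have := WellFoundedLT.toOrderBot κ.ord.ToType
  refine ⟨κ, inferInstance, inferInstance,
    { hasPushouts := inferInstance
      preservesColimit := fun i hi f hf => ?_ }⟩
  obtain ⟨i⟩ := hi
  have := ha i
  have := preservesColimitsOfShape_of_isCardinalPresentable (a i) κ κ.ord.ToType
  infer_instance

lemma eq_llp_rlp [HasColimitsOfSize.{v, v} C] [IsAccessibleCategory.{v} C]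
    {W : MorphismProperty C} (hW : CellularPaper.IsCellular W)
    (hW' : CellularPaper.retracts W ≤ W) {ι : Type v} {a b : ι → C} (s : ∀ i, a i ⟶ b i)
    (h : W = CellularPaper.cofClosure (CellularPaper.ofFamily s)) :
    W = (MorphismProperty.ofHoms s).rlp.llp := by
  rw [cofClosure_eq, ofFamily_eq] at h
  rw [retracts_eq] at hW'
  have hiso : W.RespectsIso := MorphismProperty.RespectsIso.of_respects_arrow_iso _ fun f g e hf =>
    hW' _ ⟨_, _, _, (e.symm).retract, hf⟩
  have : W.ContainsIdentities := ⟨fun _ => hW.isos _ inferInstance⟩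
  have : W.IsStableUnderCobaseChange := ⟨fun sq hf => hW.pushout sq.flip hf⟩
  have : W.IsStableUnderTransfiniteComposition := ⟨fun J _ _ _ _ => ⟨fun _ _ f hf =>
    hW.transfinite f (by
      rw [isTransfiniteCompositionOf_eq]
      exact MorphismProperty.transfiniteCompositionsOfShape_le_transfiniteCompositions _ _ _ hf)⟩⟩
  have := isStableUnderCoproducts.{v} W
  have hr : W.IsStableUnderRetracts := ⟨fun h hg => hW' _ ⟨_, _, _, h, hg⟩⟩
  have hs : MorphismProperty.ofHoms s ≤ W := by
    rw [h]
    exact (MorphismProperty.le_isoClosure _).trans <| (MorphismProperty.le_pushouts _).trans <|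
      (MorphismProperty.le_transfiniteCompositions _).trans (MorphismProperty.le_retracts _)
  refine le_antisymm ?_ ?_
  · rw [h, MorphismProperty.retracts_le_iff]
    rw [MorphismProperty.transfiniteCompositions_le_iff]
    rw [MorphismProperty.pushouts_le_iff]
    rw [MorphismProperty.isoClosure_le_iff]
    exact MorphismProperty.le_llp_rlp _
  · obtain ⟨κ, _, -, hκ⟩ := exists_isCardinalPresentable_forall a Cardinal.aleph0
    have := hasSmallObjectArgument_ofHoms s κ hκ
    rw [MorphismProperty.llp_rlp_of_hasSmallObjectArgument, MorphismProperty.retracts_le_iff]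
    rw [MorphismProperty.transfiniteCompositions_le_iff]
    rw [MorphismProperty.pushouts_le_iff]
    rw [MorphismProperty.coproducts_le_iff]
    exact hs

end Cof

section Pointwise

variable {C : Type u} [Category.{v} C]

lemma exists_natTrans_of_monotone {R J : Type*} [Preorder R] [Preorder J] {φ : R → J}
    (hφ : Monotone φ) (E : J ⥤ C) (Y : R ⥤ C) (d : ∀ j r, φ r ≤ j → (Y.obj r ⟶ E.obj j))
    (hd : ∀ j r r' (h : r ≤ r') (h' : φ r' ≤ j), res Y h ≫ d j r' h' = d j r ((hφ h).trans h'))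
    (hd' : ∀ j j' r (h : φ r ≤ j) (h' : j ≤ j'), d j r h ≫ res E h' = d j' r (h.trans h')) :
    ∃ ψ : Y ⟶ hφ.functor ⋙ E, ∀ r, ψ.app r = d (φ r) r le_rfl :=
  ⟨mkNatTrans (Y := hφ.functor ⋙ E) (fun r => d (φ r) r le_rfl) fun _ _ h =>
    (hd _ _ _ h le_rfl).trans (hd' _ _ _ le_rfl (hφ h)).symm, fun _ => rfl⟩

lemma exists_lift_of_monotone {R J : Type*} [Preorder R] [Preorder J] {φ : R → J}
    (hφ : Monotone φ) {X Y : R ⥤ C} (g : X ⟶ Y) {E₁ E₂ : J ⥤ C} (η : E₁ ⟶ E₂)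
    [HasLiftingProperty g (Functor.whiskerLeft hφ.functor η)]
    (x : ∀ j r, φ r ≤ j → (X.obj r ⟶ E₁.obj j))
    (hx : ∀ j r r' (h : r ≤ r') (h' : φ r' ≤ j), res X h ≫ x j r' h' = x j r ((hφ h).trans h'))
    (hx' : ∀ j j' r (h : φ r ≤ j) (h' : j ≤ j'), x j r h ≫ res E₁ h' = x j' r (h.trans h'))
    (y : ∀ j r, φ r ≤ j → (Y.obj r ⟶ E₂.obj j))
    (hy : ∀ j r r' (h : r ≤ r') (h' : φ r' ≤ j), res Y h ≫ y j r' h' = y j r ((hφ h).trans h'))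
    (hy' : ∀ j j' r (h : φ r ≤ j) (h' : j ≤ j'), y j r h ≫ res E₂ h' = y j' r (h.trans h'))
    (hxy : ∀ j r (h : φ r ≤ j), x j r h ≫ η.app j = g.app r ≫ y j r h) :
    ∃ l : ∀ j r, φ r ≤ j → (Y.obj r ⟶ E₁.obj j),
      (∀ j r r' (h : r ≤ r') (h' : φ r' ≤ j), res Y h ≫ l j r' h' = l j r ((hφ h).trans h')) ∧
      (∀ j j' r (h : φ r ≤ j) (h' : j ≤ j'), l j r h ≫ res E₁ h' = l j' r (h.trans h')) ∧
      (∀ j r (h : φ r ≤ j), g.app r ≫ l j r h = x j r h) ∧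
      ∀ j r (h : φ r ≤ j), l j r h ≫ η.app j = y j r h := by
  obtain ⟨α, hα⟩ := exists_natTrans_of_monotone hφ E₁ X x hx hx'
  obtain ⟨β, hβ⟩ := exists_natTrans_of_monotone hφ E₂ Y y hy hy'
  have sq : CommSq α g (Functor.whiskerLeft hφ.functor η) β := ⟨by
    ext r
    have := hxy (φ r) r le_rfl
    rw [← hα, ← hβ] at this
    exact this⟩
  let m (r) : Y.obj r ⟶ E₁.obj (φ r) := sq.lift.app r
  have hm (r) : g.app r ≫ m r = x _ r le_rfl :=
    (NatTrans.congr_app sq.fac_left r).trans (hα r)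
  have hm' (r) : m r ≫ η.app (φ r) = y _ r le_rfl :=
    (NatTrans.congr_app sq.fac_right r).trans (hβ r)
  have hm'' {r r'} (h : r ≤ r') : res Y h ≫ m r' = m r ≫ res E₁ (hφ h) :=
    sq.lift.naturality (homOfLE h)
  refine ⟨fun j r h => m r ≫ res E₁ h, fun j r r' h h' => ?_, fun j j' r h h' => ?_,
    fun j r h => ?_, fun j r h => ?_⟩
  · rw [← assoc, hm'', assoc, res_comp]
  · rw [assoc, res_comp]
  · rw [← assoc, hm, hx']
  · rw [assoc, res_naturality, ← assoc, hm', hy']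

lemma exists_factorization_pointwise [HasColimitsOfSize.{v, v} C] [IsAccessibleCategory.{v} C]
    {ι : Type v} {a b : ι → C} (S : ∀ i, a i ⟶ b i) {R : Type v} [PartialOrder R]
    {X Y : R ⥤ C} (f : X ⟶ Y) :
    ∃ (Z : R ⥤ C) (g : X ⟶ Z) (s : Z ⟶ Y), g ≫ s = f ∧
      (∀ {E₁ E₂ : R ⥤ C} (η : E₁ ⟶ E₂), (∀ r, (MorphismProperty.ofHoms S).rlp (η.app r)) →
        HasLiftingProperty g η) ∧ ∀ r, (MorphismProperty.ofHoms S).rlp (s.app r) := by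
  let S' (x : R × ι) := (evaluationLeftAdjoint C x.1).map (S x.2)
  have h {E₁ E₂ : R ⥤ C} (η : E₁ ⟶ E₂) : (MorphismProperty.ofHoms S').rlp η ↔
      ∀ r, (MorphismProperty.ofHoms S).rlp (η.app r) := by
    constructor
    · rintro h r _ _ _ ⟨i⟩
      exact ((evaluationAdjunctionRight C r).hasLiftingProperty_iff (S i) η).1 (h _ ⟨(r, i)⟩)
    · rintro h _ _ _ ⟨r, i⟩
      exact ((evaluationAdjunctionRight C r).hasLiftingProperty_iff (S i) η).2 (h r _ ⟨i⟩)
  obtain ⟨κ, _, -, hκ⟩ := exists_isCardinalPresentable_forall a Cardinal.aleph0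
  have := hasSmallObjectArgument_ofHoms S' κ fun x =>
    isCardinalPresentable_evaluationLeftAdjoint_obj κ x.1 (a x.2)
  have φ := MorphismProperty.factorizationData (MorphismProperty.ofHoms S').rlp.llp
    (MorphismProperty.ofHoms S').rlp f
  exact ⟨φ.Z, φ.i, φ.p, φ.fac, fun η hη => φ.hi _ ((h _).2 hη), (h _).1 φ.hp⟩

variable {ι : Type v} {a b : ι → C} (S : ∀ i, a i ⟶ b i) {R : Type v} [PartialOrder R]
    {X Y B : LowerSet R ⥤ C}

lemma IsGood.exists_factorization [HasColimitsOfSize.{v, v} C] [IsAccessibleCategory.{v} C]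
    (hX : IsGood X) (f : X ⟶ B) :
    ∃ (Y : LowerSet R ⥤ C) (_ : IsGood Y) (g : X ⟶ Y) (s : Y ⟶ B), g ≫ s = f ∧
      (∀ {E₁ E₂ : R ⥤ C} (η : E₁ ⟶ E₂), (∀ r, (MorphismProperty.ofHoms S).rlp (η.app r)) →
        HasLiftingProperty (Functor.whiskerLeft (iic R) g) η) ∧
      ∀ r, (MorphismProperty.ofHoms S).rlp (s.app (LowerSet.Iic r)) := by
  obtain ⟨Z, g, s, h, hg, hs⟩ :=
    exists_factorization_pointwise S (Functor.whiskerLeft (iic R) f)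
  obtain ⟨Y, hY, ⟨e⟩⟩ := exists_isGood Z
  obtain ⟨g', hg'⟩ := hX.exists_natTrans Y (fun r => g.app r ≫ e.inv.app r)
    fun r r' h => (g ≫ e.inv).naturality (homOfLE h)
  obtain ⟨s', hs'⟩ := hY.exists_natTrans B (fun r => e.hom.app r ≫ s.app r)
    fun r r' h => (e.hom ≫ s).naturality (homOfLE h)
  refine ⟨Y, hY, g', s', hX.natTrans_ext fun r => ?_, fun {E₁ E₂} η hη => ?_, fun r => ?_⟩
  · have := NatTrans.congr_app h r
    simp only [NatTrans.comp_app, hg', hs']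
    exact (assoc _ _ _).trans <| (congrArg (g.app r ≫ ·) (e.inv_hom_id_app_assoc r _)).trans this
  · have e' : Functor.whiskerLeft (iic R) g' = g ≫ e.inv := by
      ext r
      exact hg' r
    rw [e']
    have := hg η hη
    infer_instance
  · rw [hs']
    exact MorphismProperty.RespectsIso.precomp _ (e.app r).hom _ (hs r)

lemma IsGood.exists_corner_lift [HasPushouts C] (hX : IsGood X) (hY : IsGood Y) {g : X ⟶ Y}
    (hg : ∀ {E₁ E₂ : R ⥤ C} (η : E₁ ⟶ E₂), (∀ r, (MorphismProperty.ofHoms S).rlp (η.app r)) →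
      HasLiftingProperty (Functor.whiskerLeft (iic R) g) η)
    {T T' : LowerSet R} (hT : T ≤ T') {P Q : C} (p : P ⟶ Q) (hp : (MorphismProperty.ofHoms S).rlp p)
    (x : X.obj T' ⟶ P) (y : Y.obj T ⟶ P) (z : Y.obj T' ⟶ Q)
    (hxy : res X hT ≫ x = g.app T ≫ y) (hxz : g.app T' ≫ z = x ≫ p) (hyz : res Y hT ≫ z = y ≫ p) :
    ∃ l : Y.obj T' ⟶ P, g.app T' ≫ l = x ∧ res Y hT ≫ l = y ∧ l ≫ p = z := by
  classical
  have hz := pushout.condition (f := z) (g := res Y (le_top : T' ≤ ⊤))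
  have hx₂ {r} (hr : r ∈ T') : (res X (iic_le hr) ≫ x) ≫ p ≫ pushout.inl z (res Y le_top) =
      g.app _ ≫ res Y le_top ≫ pushout.inr z (res Y le_top) := by
    rw [assoc, ← reassoc_of% hxz, hz, res_naturality_assoc, res_comp_assoc]
  have hy₁ {r} (hr : r ∈ T) : (res Y (iic_le hr) ≫ y) ≫ p = res Y (iic_le (hT hr)) ≫ z := by
    rw [assoc, ← hyz, res_comp_assoc]
  have hy₃ {r} (hr : r ∈ T') : (res Y (iic_le hr) ≫ z) ≫ pushout.inl z (res Y le_top) =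
      res Y le_top ≫ pushout.inr z (res Y le_top) := by
    rw [assoc, hz, res_comp_assoc]
  have hy₂ {r} (hr : r ∈ T) : (res Y (iic_le hr) ≫ y) ≫ p ≫ pushout.inl z (res Y le_top) =
      res Y le_top ≫ pushout.inr z (res Y le_top) := by
    rw [← assoc, hy₁ hr, hy₃ (hT hr)]
  have hxy₀ {r} (hr : r ∈ T) : res X (iic_le (hT hr)) ≫ x =
      g.app _ ≫ res Y (iic_le hr) ≫ y := by
    rw [← res_naturality_assoc, ← hxy, res_comp_assoc]
  have hxy₁ {r} (hr : r ∈ T') : (res X (iic_le hr) ≫ x) ≫ p =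
      g.app _ ≫ res Y (iic_le hr) ≫ z := by
    rw [assoc, ← hxz, res_naturality_assoc]
  let φ (r : R) : Fin 3 := if r ∈ T then 0 else if r ∈ T' then 1 else 2
  have hφ₀ {r} (h : φ r ≤ 0) : r ∈ T := by
    by_contra h'
    by_cases h'' : r ∈ T' <;> simp [φ, h', h''] at h
  have hφ₁ {r} (h : φ r ≤ 1) : r ∈ T' := by
    by_contra h'
    have : r ∉ T := fun h => h' (hT h)
    simp [φ, h', this] at h
  have hφ₀' {r} (h : r ∈ T) : φ r ≤ 0 := by simp [φ, h]
  have hφ₁' {r} (h : r ∈ T') : φ r ≤ 1 := by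
    by_cases h' : r ∈ T <;> simp [φ, h, h']
  have hφ : Monotone φ := fun r r' h => by
    by_cases h₀ : r' ∈ T
    · exact (hφ₀' (T.lower h h₀)).trans (Fin.zero_le _)
    · by_cases h₁ : r' ∈ T'
      · exact (hφ₁' (T'.lower h h₁)).trans (by simp [φ, h₀, h₁])
      · simpa [φ, h₀, h₁] using Fin.le_last (φ r)
  let E₁ : Fin 3 ⥤ C := ComposableArrows.mk₂ (𝟙 P) (p ≫ pushout.inl z (res Y le_top))
  let E₂ : Fin 3 ⥤ C := ComposableArrows.mk₂ p (pushout.inl z (res Y le_top))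
  let η : E₁ ⟶ E₂ := ComposableArrows.homMk₂ (𝟙 P) p (𝟙 _) rfl (comp_id _)
  have hη (j : Fin 3) : (MorphismProperty.ofHoms S).rlp (η.app j) :=
    match j with
    | 0 => MorphismProperty.id_mem _ _
    | 1 => hp
    | 2 => MorphismProperty.id_mem _ _
  have := hg (Functor.whiskerLeft hφ.functor η) fun r => hη _
  obtain ⟨l, hl₁, hl₂, hl₃, hl₄⟩ := exists_lift_of_monotone hφ
    (Functor.whiskerLeft (iic R) g) η
    (fun j => match j with
      | 0 => fun r h => res X (iic_le (hT (hφ₀ h))) ≫ x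
      | 1 => fun r h => res X (iic_le (hφ₁ h)) ≫ x
      | 2 => fun r h => g.app _ ≫ res Y le_top ≫ pushout.inr z (res Y le_top))
    (fun j r r' h h' => match j, h' with
      | 0, _ => res_comp_assoc X (iic_mono h) _ _
      | 1, _ => res_comp_assoc X (iic_mono h) _ _
      | 2, _ => (res_naturality_assoc g (iic_mono h) _).trans
          (congrArg (g.app _ ≫ ·) (res_comp_assoc Y _ _ _)))
    (fun j j' r h h' => match j, j', h, h' with
      | 0, 0, _, _ => comp_id _
      | 0, 1, _, _ => comp_id _
      | 0, 2, h, _ => (congrArg (_ ≫ ·) (id_comp _)).trans (hx₂ (hT (hφ₀ h)))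
      | 1, 0, _, h' => absurd h' (by decide)
      | 1, 1, _, _ => comp_id _
      | 1, 2, h, _ => hx₂ (hφ₁ h)
      | 2, 0, _, h' => absurd h' (by decide)
      | 2, 1, _, h' => absurd h' (by decide)
      | 2, 2, _, _ => comp_id _)
    (fun j => match j with
      | 0 => fun r h => res Y (iic_le (hφ₀ h)) ≫ y
      | 1 => fun r h => res Y (iic_le (hφ₁ h)) ≫ z
      | 2 => fun r h => res Y le_top ≫ pushout.inr z (res Y le_top))
    (fun j r r' h h' => match j, h' with
      | 0, _ => res_comp_assoc Y (iic_mono h) _ _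
      | 1, _ => res_comp_assoc Y (iic_mono h) _ _
      | 2, _ => res_comp_assoc Y (iic_mono h) _ _)
    (fun j j' r h h' => match j, j', h, h' with
      | 0, 0, _, _ => comp_id _
      | 0, 1, h, _ => hy₁ (hφ₀ h)
      | 0, 2, h, _ => hy₂ (hφ₀ h)
      | 1, 0, _, h' => absurd h' (by decide)
      | 1, 1, _, _ => comp_id _
      | 1, 2, h, _ => hy₃ (hφ₁ h)
      | 2, 0, _, h' => absurd h' (by decide)
      | 2, 1, _, h' => absurd h' (by decide)
      | 2, 2, _, _ => comp_id _)
    (fun j r h => match j, h with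
      | 0, h => (comp_id _).trans (hxy₀ (hφ₀ h))
      | 1, h => hxy₁ (hφ₁ h)
      | 2, h => comp_id _)
  obtain ⟨m, hm⟩ := hY.exists_desc (T := T') (Z := P)
    (fun r hr => l 1 r (hφ₁' hr)) fun r r' h h' => hl₁ _ _ _ h _
  refine ⟨m, hX.hom_ext fun r hr => ?_, hY.hom_ext fun r hr => ?_, hY.hom_ext fun r hr => ?_⟩
  · rw [res_naturality_assoc, hm _ hr]
    exact hl₃ 1 r _
  · rw [res_comp_assoc, hm _ (hT hr)]
    refine (hl₂ 0 1 r (hφ₀' hr) (Fin.zero_le _)).symm.trans <| (comp_id _).trans <|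
      (comp_id _).symm.trans (hl₄ 0 r (hφ₀' hr))
  · rw [← assoc, hm _ hr]
    exact hl₄ 1 r (hφ₁' hr)

lemma IsGood.rlp_app_top {Z B : LowerSet R ⥤ C} (hZ : IsGood Z) (hB : IsGood B) (s : Z ⟶ B)
    (κ : Cardinal.{v})
    [Fact κ.IsRegular] [IsCardinalFiltered R κ] (ha : ∀ i, IsCardinalPresentable (a i) κ)
    (hb : ∀ i, IsCardinalPresentable (b i) κ)
    (hs : ∀ r, (MorphismProperty.ofHoms S).rlp (s.app (LowerSet.Iic r))) :
    (MorphismProperty.ofHoms S).rlp (s.app ⊤) := by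
  have := isFiltered_of_isCardinalFiltered R κ
  have : IsDirectedOrder R := ⟨fun x y => ⟨IsFiltered.max x y,
    leOfHom (IsFiltered.leftToMax x y), leOfHom (IsFiltered.rightToMax x y)⟩⟩
  have hc {D : LowerSet R ⥤ C} (hD : IsGood D) :
      Nonempty (IsColimit (boundCocone D (iic R) ⊤ fun _ => le_top)) :=
    hD.isColimit_of_directed _ _ _ fun r _ => ⟨r, LowerSet.mem_Iic_iff.2 le_rfl⟩
  obtain ⟨cZ⟩ := hc hZ
  obtain ⟨cB⟩ := hc hB
  rintro _ _ _ ⟨i⟩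
  refine ⟨fun {x y} sq => ?_⟩
  have := ha i
  have := hb i
  obtain ⟨r, x', hx'⟩ : ∃ (r : R) (x' : a i ⟶ Z.obj (LowerSet.Iic r)), x' ≫ res Z le_top = x :=
    IsCardinalPresentable.exists_hom_of_isColimit κ cZ x
  obtain ⟨r', y', hy'⟩ : ∃ (r : R) (y' : b i ⟶ B.obj (LowerSet.Iic r)), y' ≫ res B le_top = y :=
    IsCardinalPresentable.exists_hom_of_isColimit κ cB y
  obtain ⟨q, hq, hq', e⟩ : ∃ (q : R) (h : r ≤ q) (h' : r' ≤ q),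
      (x' ≫ s.app _) ≫ res B (iic_mono h) = (S i ≫ y') ≫ res B (iic_mono h') := by
    obtain ⟨q, h, h', e⟩ := IsCardinalPresentable.exists_eq_of_isColimit κ cB
      (i₁ := r) (i₂ := r') (x' ≫ s.app _) (S i ≫ y') (by
        change (x' ≫ s.app _) ≫ res B le_top = (S i ≫ y') ≫ res B le_top
        rw [assoc, ← res_naturality, ← assoc, hx', assoc, hy', sq.w])
    exact ⟨q, leOfHom h, leOfHom h', e⟩
  have sq' : CommSq (x' ≫ res Z (iic_mono hq)) (S i) (s.app _) (y' ≫ res B (iic_mono hq')) :=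
    ⟨by rw [assoc, res_naturality, ← assoc, e, assoc]⟩
  have := hs q _ ⟨i⟩
  exact CommSq.HasLift.mk' {
    l := sq'.lift ≫ res Z le_top
    fac_left := by rw [← assoc, sq'.fac_left, assoc, res_comp, hx']
    fac_right := by rw [assoc, res_naturality, ← assoc, sq'.fac_right, assoc, res_comp, hy'] }

end Pointwise

section PartialSection

variable {C : Type u} [Category.{v} C] {R : Type v} [PartialOrder R]

/-- The lower sets with less than `κ` elements. -/
abbrev SmallLowerSet (R : Type v) [PartialOrder R] (κ : Cardinal.{v}) : Type v :=
  { D : LowerSet R // HasCardinalLT D κ }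

lemma hasCardinalLT_iSup {I : Type v} {κ : Cardinal.{v}} [Fact κ.IsRegular]
    (hI : HasCardinalLT I κ) (D : I → LowerSet R) (hD : ∀ i, HasCardinalLT (D i) κ) :
    HasCardinalLT (⨆ i, D i : LowerSet R) κ := by
  have : HasCardinalLT (⋃ i, (D i : Set R)) κ := hasCardinalLT_iUnion _ hI hD
  rw [← LowerSet.coe_iSup] at this
  exact this

instance (κ : Cardinal.{v}) [Fact κ.IsRegular] : IsCardinalFiltered (SmallLowerSet R κ) κ :=
  isCardinalFiltered_preorder _ _ fun _ D hK =>
    ⟨⟨⨆ k, (D k).1, hasCardinalLT_iSup ((hasCardinalLT_iff_cardinal_mk_lt _ _).2 hK) _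
      fun k => (D k).2⟩, fun k => le_iSup (fun k => (D k).1) k⟩

lemma hasCardinalLT_arrow {P : Type v} [PartialOrder P] {κ : Cardinal.{v}}
    (hκ : Cardinal.aleph0 ≤ κ) (h : HasCardinalLT P κ) : HasCardinalLT (Arrow P) κ :=
  (hasCardinalLT_prod hκ h h).of_injective (fun f : Arrow P => (f.left, f.right)) <| by
    rintro ⟨a, b, f⟩ ⟨a', b', f'⟩ h
    obtain ⟨rfl, rfl⟩ := Prod.ext_iff.1 h
    obtain rfl : f = f' := Subsingleton.elim _ _
    rfl

lemma IsGood.isCardinalPresentable {X : LowerSet R ⥤ C} (hX : IsGood X) (κ : Cardinal.{v})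
    [Fact κ.IsRegular] (hX' : ∀ r, IsCardinalPresentable (X.obj (LowerSet.Iic r)) κ)
    (T : LowerSet R) (hT : HasCardinalLT T κ) : IsCardinalPresentable (X.obj T) κ := by
  have (r : T) : IsCardinalPresentable ((iicOn T ⋙ X).obj r) κ := hX' r
  exact isCardinalPresentable_of_isColimit _ (hX T).some κ
    (hasCardinalLT_arrow (Cardinal.IsRegular.aleph0_le Fact.out) hT)

variable {X B Y : LowerSet R ⥤ C}

lemma inf_mono_right {T D D' : LowerSet R} (h : D ≤ D') : T ⊓ D ≤ T ⊓ D' := inf_le_inf_left T h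

/-- The diagram of the intersections of `T` with small lower sets. -/
abbrev infSmall (κ : Cardinal.{v}) (T : LowerSet R) : SmallLowerSet R κ ⥤ LowerSet R :=
  Monotone.functor (f := fun D : SmallLowerSet R κ => T ⊓ D.1) fun _ _ h => inf_mono_right h

lemma hasCardinalLT_inf {κ : Cardinal.{v}} (T : LowerSet R) {D : LowerSet R}
    (hD : HasCardinalLT D κ) : HasCardinalLT (T ⊓ D : LowerSet R) κ :=
  hD.of_injective (fun x => ⟨x.1, x.2.2⟩) fun _ _ h =>
    Subtype.ext (congrArg (fun x : D => (x : R)) h)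

instance (κ : Cardinal.{v}) [Fact κ.IsRegular] : IsDirectedOrder (SmallLowerSet R κ) where
  directed x y := by
    have := isFiltered_of_isCardinalFiltered (SmallLowerSet R κ) κ
    exact ⟨IsFiltered.max x y, leOfHom (IsFiltered.leftToMax x y),
      leOfHom (IsFiltered.rightToMax x y)⟩

instance (κ : Cardinal.{v}) [Fact κ.IsRegular] : Nonempty (SmallLowerSet R κ) := by
  have := isFiltered_of_isCardinalFiltered (SmallLowerSet R κ) κ
  exact IsFiltered.nonempty

section

variable {κ : Cardinal.{v}} [Fact κ.IsRegular]

lemma IsGood.nonempty_isColimit_infSmall (hX : IsGood X)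
    (hκ : ∀ r : R, HasCardinalLT (LowerSet.Iic r) κ)
    (T : LowerSet R) :
    Nonempty (IsColimit (boundCocone X (infSmall κ T) T fun _ => inf_le_left)) :=
  hX.isColimit_of_directed _ _ _ fun r hr =>
    ⟨⟨LowerSet.Iic r, hκ r⟩, hr, LowerSet.mem_Iic_iff.2 le_rfl⟩

lemma IsGood.exists_hom (hX : IsGood X) (hκ : ∀ r : R, HasCardinalLT (LowerSet.Iic r) κ)
    (T : LowerSet R) {Z : C} [IsCardinalPresentable Z κ] (a : Z ⟶ X.obj T) :
    ∃ (D : SmallLowerSet R κ) (b : Z ⟶ X.obj (T ⊓ D.1)), b ≫ res X inf_le_left = a :=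
  IsCardinalPresentable.exists_hom_of_isColimit κ (hX.nonempty_isColimit_infSmall hκ T).some a

lemma IsGood.eventually_eq (hX : IsGood X) (hκ : ∀ r : R, HasCardinalLT (LowerSet.Iic r) κ)
    (T : LowerSet R) {Z : C} (hZ : IsCardinalPresentable Z κ) {D₁ D₂ : SmallLowerSet R κ}
    (a : Z ⟶ X.obj (T ⊓ D₁.1)) (b : Z ⟶ X.obj (T ⊓ D₂.1))
    (h : a ≫ res X inf_le_left = b ≫ res X inf_le_left) :
    ∀ᶠ D : SmallLowerSet R κ in Filter.atTop, ∀ (h₁ : D₁ ≤ D) (h₂ : D₂ ≤ D),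
      a ≫ res X (inf_mono_right h₁) = b ≫ res X (inf_mono_right h₂) := by
  obtain ⟨D, h₁, h₂, e⟩ : ∃ (D : SmallLowerSet R κ) (h₁ : D₁ ≤ D) (h₂ : D₂ ≤ D),
      a ≫ res X (inf_mono_right h₁) = b ≫ res X (inf_mono_right h₂) := by
    obtain ⟨D, h₁, h₂, e⟩ := IsCardinalPresentable.exists_eq_of_isColimit κ
      (hX.nonempty_isColimit_infSmall hκ T).some a b h
    exact ⟨D, leOfHom h₁, leOfHom h₂, e⟩
  filter_upwards [Filter.eventually_ge_atTop D] with D' hD' _ _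
  have := congr_arg (· ≫ res X (inf_mono_right hD')) e
  simpa using this

end

/-- A compatible family of partial sections of `s` below a family of sections `v`. -/
structure PartialSection (f : X ⟶ B) (g : X ⟶ Y) (s : Y ⟶ B) {J : Type*} [Preorder J]
    (τ : J →o LowerSet R) (v : ∀ j, B.obj (τ j) ⟶ Y.obj (τ j)) (E D : LowerSet R) where
  le : E ≤ D
  u (j : J) : B.obj (τ j ⊓ E) ⟶ Y.obj (τ j ⊓ D)
  u_res (j : J) : u j ≫ res Y inf_le_left = res B inf_le_left ≫ v j
  f_u (j : J) : f.app _ ≫ u j = g.app _ ≫ res Y (inf_mono_right le)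
  u_s (j : J) : u j ≫ s.app _ = res B (inf_mono_right le)
  res_u {j j' : J} (h : j ≤ j') : res B (inf_le_inf_right E (τ.monotone h)) ≫ u j' =
    u j ≫ res Y (inf_le_inf_right D (τ.monotone h))

variable {f : X ⟶ B} {g : X ⟶ Y} {s : Y ⟶ B} {J : Type*} [Preorder J]
    {τ : J →o LowerSet R} {v : ∀ j, B.obj (τ j) ⟶ Y.obj (τ j)}

lemma exists_partialSection_of_smallLowerSet [Finite J] (hX : IsGood X) (hB : IsGood B)
    (hY : IsGood Y)
    {κ : Cardinal.{v}} [Fact κ.IsRegular] (hκ : ∀ r : R, HasCardinalLT (LowerSet.Iic r) κ)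
    (hX' : ∀ r, IsCardinalPresentable (X.obj (LowerSet.Iic r)) κ)
    (hB' : ∀ r, IsCardinalPresentable (B.obj (LowerSet.Iic r)) κ)
    (hfv : ∀ j, f.app _ ≫ v j = g.app _) (hvs : ∀ j, v j ≫ s.app _ = 𝟙 _)
    (hv : ∀ j j' (h : j ≤ j'), res B (τ.monotone h) ≫ v j' = v j ≫ res Y (τ.monotone h))
    (E : SmallLowerSet R κ) :
    ∃ D : SmallLowerSet R κ, Nonempty (PartialSection f g s τ v E.1 D.1) := by
  have hB₁ (j : J) : IsCardinalPresentable (B.obj (τ j ⊓ E.1)) κ :=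
    hB.isCardinalPresentable κ hB' _ (hasCardinalLT_inf _ E.2)
  have hX₁ (j : J) : IsCardinalPresentable (X.obj (τ j ⊓ E.1)) κ :=
    hX.isCardinalPresentable κ hX' _ (hasCardinalLT_inf _ E.2)
  choose D u hu using fun j => hY.exists_hom hκ (τ j) (res B (inf_le_left : τ j ⊓ E.1 ≤ _) ≫ v j)
  have h₁ : ∀ᶠ D' : SmallLowerSet R κ in Filter.atTop, ∀ j, D j ≤ D' :=
    Filter.eventually_all.2 fun j => Filter.eventually_ge_atTop _
  have h₂ : ∀ᶠ D' : SmallLowerSet R κ in Filter.atTop, ∀ j,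
      ∀ (h : D j ≤ D') (h' : E ≤ D'), (f.app _ ≫ u j) ≫ res Y (inf_mono_right h) =
        g.app _ ≫ res Y (inf_mono_right h') :=
    Filter.eventually_all.2 fun j => hY.eventually_eq hκ (τ j) (hX₁ j) _ _ <| by
      rw [assoc, hu, ← res_naturality_assoc, hfv, res_naturality]
  have h₃ : ∀ᶠ D' : SmallLowerSet R κ in Filter.atTop, ∀ j,
      ∀ (h : D j ≤ D') (h' : E ≤ D'), (u j ≫ s.app _) ≫ res B (inf_mono_right h) =
        𝟙 _ ≫ res B (inf_mono_right h') :=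
    Filter.eventually_all.2 fun j => hB.eventually_eq hκ (τ j) (hB₁ j) _ _ <| by
      rw [assoc, ← res_naturality, ← assoc, hu, assoc, hvs, id_comp, comp_id]
  have h₄ : ∀ᶠ D' : SmallLowerSet R κ in Filter.atTop, ∀ (j j' : J) (hj : j ≤ j'),
      ∀ (h : D j' ≤ D') (h' : D j ≤ D'),
        (res B (inf_le_inf_right E.1 (τ.monotone hj)) ≫ u j') ≫ res Y (inf_mono_right h) =
        (u j ≫ res Y (inf_le_inf_right (D j).1 (τ.monotone hj))) ≫ res Y (inf_mono_right h') :=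
    Filter.eventually_all.2 fun j => Filter.eventually_all.2 fun j' =>
      Filter.eventually_all.2 fun hj => hY.eventually_eq hκ (τ j') (hB₁ j) _ _ <| by
        rw [assoc, hu, assoc, res_comp, res_comp_assoc,
          ← res_comp Y inf_le_left (τ.monotone hj), ← assoc (u j), hu, assoc, ← hv j j' hj,
          res_comp_assoc]
  obtain ⟨D', h₁, h₂, h₃, h₄, hE⟩ :=
    (h₁.and (h₂.and (h₃.and (h₄.and (Filter.eventually_ge_atTop E))))).exists
  refine ⟨D', ⟨⟨hE, fun j => u j ≫ res Y (inf_mono_right (h₁ j)), fun j => ?_, fun j => ?_,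
    fun j => ?_, fun {j j'} h => ?_⟩⟩⟩
  · rw [assoc, res_comp, hu]
  · rw [← h₂ j (h₁ j) hE, assoc]
  · rw [assoc, res_naturality, ← assoc, h₃ j (h₁ j) hE, id_comp]
  · rw [← assoc, h₄ j j' h (h₁ j') (h₁ j), assoc, assoc, res_comp, res_comp]

lemma PartialSection.exists_next [Finite J] (hX : IsGood X) (hB : IsGood B) (hY : IsGood Y)
    {κ : Cardinal.{v}} [Fact κ.IsRegular] (hκ : ∀ r : R, HasCardinalLT (LowerSet.Iic r) κ)
    (hX' : ∀ r, IsCardinalPresentable (X.obj (LowerSet.Iic r)) κ)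
    (hB' : ∀ r, IsCardinalPresentable (B.obj (LowerSet.Iic r)) κ)
    (hfv : ∀ j, f.app _ ≫ v j = g.app _) (hvs : ∀ j, v j ≫ s.app _ = 𝟙 _)
    (hv : ∀ j j' (h : j ≤ j'), res B (τ.monotone h) ≫ v j' = v j ≫ res Y (τ.monotone h))
    {E D : SmallLowerSet R κ} (x : PartialSection f g s τ v E.1 D.1) :
    ∃ (D' : SmallLowerSet R κ) (y : PartialSection f g s τ v D.1 D'.1), ∀ j,
      x.u j ≫ res Y (inf_mono_right y.le) = res B (inf_mono_right x.le) ≫ y.u j := by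
  obtain ⟨D₁, ⟨z⟩⟩ :=
    exists_partialSection_of_smallLowerSet hX hB hY hκ hX' hB' hfv hvs hv D
  have h : ∀ᶠ D' : SmallLowerSet R κ in Filter.atTop, ∀ j, ∀ (h : D ≤ D') (h' : D₁ ≤ D'),
      x.u j ≫ res Y (inf_mono_right h) =
        (res B (inf_mono_right x.le) ≫ z.u j) ≫ res Y (inf_mono_right h') :=
    Filter.eventually_all.2 fun j => hY.eventually_eq hκ (τ j)
      (hB.isCardinalPresentable κ hB' _ (hasCardinalLT_inf _ E.2)) _ _ <| by
        rw [x.u_res, assoc, z.u_res, res_comp_assoc]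
  obtain ⟨D', h, hD₁⟩ := (h.and (Filter.eventually_ge_atTop D₁)).exists
  refine ⟨D', ⟨z.le.trans hD₁, fun j => z.u j ≫ res Y (inf_mono_right hD₁), fun j => ?_,
    fun j => ?_, fun j => ?_, fun {j j'} h => ?_⟩, fun j => ?_⟩
  · rw [assoc, res_comp, z.u_res]
  · rw [← assoc, z.f_u, assoc, res_comp]
  · rw [assoc, res_naturality, ← assoc, z.u_s, res_comp]
  · rw [← assoc, z.res_u h, assoc, assoc, res_comp, res_comp]
  · rw [h j (z.le.trans hD₁) hD₁, assoc]

/-- Any small lower set is contained in a small lower set over which the given sections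
restrict. -/
lemma exists_partialSection [Finite J] (hX : IsGood X) (hB : IsGood B) (hY : IsGood Y)
    {κ : Cardinal.{v}} [Fact κ.IsRegular] (hκ₀ : Cardinal.aleph0 < κ)
    (hκ : ∀ r : R, HasCardinalLT (LowerSet.Iic r) κ)
    (hX' : ∀ r, IsCardinalPresentable (X.obj (LowerSet.Iic r)) κ)
    (hB' : ∀ r, IsCardinalPresentable (B.obj (LowerSet.Iic r)) κ)
    (hfv : ∀ j, f.app _ ≫ v j = g.app _) (hvs : ∀ j, v j ≫ s.app _ = 𝟙 _)
    (hv : ∀ j j' (h : j ≤ j'), res B (τ.monotone h) ≫ v j' = v j ≫ res Y (τ.monotone h))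
    (D₀ : SmallLowerSet R κ) :
    ∃ D : SmallLowerSet R κ, D₀ ≤ D ∧ Nonempty (PartialSection f g s τ v D.1 D.1) := by
  obtain ⟨D₁, ⟨x₀⟩⟩ :=
    exists_partialSection_of_smallLowerSet hX hB hY hκ hX' hB' hfv hvs hv D₀
  let St := Σ E D : SmallLowerSet R κ, PartialSection f g s τ v E.1 D.1
  have hnext (x : St) : ∃ y : St, ∃ h : x.2.1 ≤ y.1, ∀ j,
      x.2.2.u j ≫ res Y (inf_mono_right (h.trans y.2.2.le)) =
        res B (inf_mono_right (x.2.2.le.trans h)) ≫ y.2.2.u j := by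
    obtain ⟨D', y, hy⟩ := x.2.2.exists_next hX hB hY hκ hX' hB' hfv hvs hv
    exact ⟨⟨_, D', y⟩, le_rfl, hy⟩
  choose next h hu using hnext
  let x (n : ℕ) : St := next^[n] ⟨D₀, D₁, x₀⟩
  have hx (n : ℕ) : ∃ h : (x n).2.1 ≤ (x (n + 1)).1, ∀ j,
      (x n).2.2.u j ≫ res Y (inf_mono_right (h.trans (x (n + 1)).2.2.le)) =
        res B (inf_mono_right ((x n).2.2.le.trans h)) ≫ (x (n + 1)).2.2.u j := by
    have : x (n + 1) = next (x n) := Function.iterate_succ_apply' _ _ _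
    rw [this]
    exact ⟨h _, hu _⟩
  choose h hu using hx
  let E (n : ℕ) : LowerSet R := (x n).1.1
  have hE : Monotone E := monotone_nat_of_le_succ fun n => (x n).2.2.le.trans (h n)
  let D : LowerSet R := ⨆ n, E n
  have hED (n : ℕ) : E n ≤ D := le_iSup E n
  have hDD (n : ℕ) : (x n).2.1.1 ≤ D := le_trans (b := E (n + 1)) (h n) (hED (n + 1))
  have hD : HasCardinalLT D κ := by
    have : HasCardinalLT (ULift.{v} ℕ) κ := by
      rw [hasCardinalLT_iff_cardinal_mk_lt]
      simpa using hκ₀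
    have := hasCardinalLT_iSup this (fun n => E n.down) fun n => (x n.down).1.2
    have e : ⨆ n : ULift.{v} ℕ, E n.down = D := Equiv.ulift.iSup_comp (g := E)
    rwa [e] at this
  have hc {W : LowerSet R ⥤ C} (hW : IsGood W) (j : J) := hW.isColimit_of_directed
    (Monotone.functor (f := fun n => τ j ⊓ E n) fun _ _ h => inf_mono_right (hE h)) (τ j ⊓ D)
    (fun n => inf_mono_right (hED n)) fun r hr => by
      obtain ⟨n, hn⟩ := LowerSet.mem_iSup_iff.1 hr.2
      exact ⟨n, hr.1, hn⟩
  have hext {W : LowerSet R ⥤ C} (hW : IsGood W) (j : J) {Z : C} {a b : W.obj (τ j ⊓ D) ⟶ Z}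
      (hab : ∀ n, res W (inf_mono_right (hED n)) ≫ a = res W (inf_mono_right (hED n)) ≫ b) :
      a = b := (hc hW j).some.hom_ext hab
  have hw (j : J) {m n : ℕ} (hmn : m ≤ n) : res B (inf_mono_right (hE hmn)) ≫ (x n).2.2.u j ≫
      res Y (inf_mono_right (hDD n)) = (x m).2.2.u j ≫ res Y (inf_mono_right (hDD m)) := by
    induction n, hmn using Nat.le_induction with
    | base => rw [res_refl, id_comp]
    | succ n hmn ih =>
      rw [← ih, ← res_comp_assoc B (inf_mono_right (hE hmn))
        (inf_mono_right ((x n).2.2.le.trans (h n))), ← reassoc_of% hu, res_comp]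
  have hu' (j : J) : ∃ u : B.obj (τ j ⊓ D) ⟶ Y.obj (τ j ⊓ D), ∀ n,
      res B (inf_mono_right (hED n)) ≫ u =
        (x n).2.2.u j ≫ res Y (inf_mono_right (hDD n)) :=
    ⟨(hc hB j).some.desc (mkCocone (fun n => (x n).2.2.u j ≫ res Y (inf_mono_right (hDD n)))
      fun m n hmn => hw j hmn), fun n => (hc hB j).some.fac _ n⟩
  choose u hu' using hu'
  refine ⟨⟨D, hD⟩, hED 0, ⟨⟨le_rfl, u, fun j => hext hB j fun n => ?_,
    fun j => hext hX j fun n => ?_, fun j => hext hB j fun n => ?_,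
    fun {j j'} hj => hext hB j fun n => ?_⟩⟩⟩
  · rw [← assoc, hu', assoc, res_comp, (x n).2.2.u_res, res_comp_assoc]
  · rw [res_naturality_assoc, hu', ← assoc, (x n).2.2.f_u, assoc, res_comp, res_naturality_assoc,
      res_comp]
  · rw [← assoc, hu', assoc, res_naturality, ← assoc, (x n).2.2.u_s, res_comp, res_comp]
  · rw [res_comp_assoc, ← res_comp_assoc B (inf_le_inf_right (E n) (τ.monotone hj))
      (inf_mono_right (hED n)), hu', ← assoc, (x n).2.2.res_u hj, assoc, res_comp, ← assoc, hu',
      assoc, res_comp]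

end PartialSection

section Step

variable {C : Type u} [Category.{v} C] {R : Type v} [PartialOrder R] {X B Y : LowerSet R ⥤ C}

/-- A lift of `g` through `f` over `T` which is a section of `s` compatible with `v`. -/
structure IsSection (f : X ⟶ B) (g : X ⟶ Y) (s : Y ⟶ B) (v : B.obj ⊤ ⟶ Y.obj ⊤) {T : LowerSet R}
    (w : B.obj T ⟶ Y.obj T) : Prop where
  fac : f.app T ≫ w = g.app T
  comp_app : w ≫ s.app T = 𝟙 _
  comp_res : w ≫ res Y le_top = res B le_top ≫ v

variable {f : X ⟶ B} {g : X ⟶ Y} {s : Y ⟶ B} {v : B.obj ⊤ ⟶ Y.obj ⊤}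

lemma IsSection.exists_smallLowerSet (hX : IsGood X) (hB : IsGood B) (hY : IsGood Y)
    {κ : Cardinal.{v}} [Fact κ.IsRegular] (hκ₀ : Cardinal.aleph0 < κ)
    (hκ : ∀ r : R, HasCardinalLT (LowerSet.Iic r) κ)
    (hX' : ∀ r, IsCardinalPresentable (X.obj (LowerSet.Iic r)) κ)
    (hB' : ∀ r, IsCardinalPresentable (B.obj (LowerSet.Iic r)) κ)
    (hv : IsSection f g s v v) {T : LowerSet R} {w : B.obj T ⟶ Y.obj T}
    (hw : IsSection f g s v w) (D₀ : SmallLowerSet R κ) :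
    ∃ D : SmallLowerSet R κ, D₀ ≤ D ∧
      ∃ (u : B.obj (T ⊓ D.1) ⟶ Y.obj (T ⊓ D.1)) (u' : B.obj D.1 ⟶ Y.obj D.1),
        IsSection f g s v u ∧ IsSection f g s v u' ∧
          u ≫ res Y inf_le_left = res B inf_le_left ≫ w ∧
          u ≫ res Y inf_le_right = res B inf_le_right ≫ u' := by
  let τ : Bool →o LowerSet R := ⟨fun b => match b with
    | false => T
    | true => ⊤, fun
      | false, false, _ => le_rfl
      | false, true, _ => le_top
      | true, true, _ => le_rfl⟩
  let v' (j : Bool) : B.obj (τ j) ⟶ Y.obj (τ j) := match j with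
    | false => w
    | true => v
  obtain ⟨D, hD, ⟨x⟩⟩ := exists_partialSection (f := f) (g := g) (s := s) (τ := τ) (v := v')
    hX hB hY hκ₀ hκ hX' hB'
    (fun | false => hw.fac | true => hv.fac)
    (fun | false => hw.comp_app | true => hv.comp_app)
    (fun
      | false, false, _ => (congrArg (· ≫ w) (res_refl B _)).trans
          ((id_comp w).trans ((comp_id w).symm.trans (congrArg (w ≫ ·) (res_refl Y _).symm)))
      | false, true, _ => hw.comp_res.symm
      | true, true, _ => (congrArg (· ≫ v) (res_refl B _)).trans
          ((id_comp v).trans ((comp_id v).symm.trans (congrArg (v ≫ ·) (res_refl Y _).symm)))) D₀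
  obtain ⟨u, hu⟩ : ∃ u : B.obj (T ⊓ D.1) ⟶ Y.obj (T ⊓ D.1), u = x.u false := ⟨_, rfl⟩
  obtain ⟨u', hu'⟩ : ∃ u' : B.obj (⊤ ⊓ D.1) ⟶ Y.obj (⊤ ⊓ D.1), u' = x.u true := ⟨_, rfl⟩
  have h₁ : u ≫ res Y inf_le_left = res B inf_le_left ≫ w := hu ▸ x.u_res false
  have h₁' : u' ≫ res Y inf_le_left = res B inf_le_left ≫ v := hu' ▸ x.u_res true
  have h₂ : f.app _ ≫ u = g.app _ :=
    hu ▸ (x.f_u false).trans ((congrArg (_ ≫ ·) (res_refl Y _)).trans (comp_id _))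
  have h₂' : f.app _ ≫ u' = g.app _ :=
    hu' ▸ (x.f_u true).trans ((congrArg (_ ≫ ·) (res_refl Y _)).trans (comp_id _))
  have h₃ : u ≫ s.app _ = 𝟙 _ := hu ▸ (x.u_s false).trans (res_refl B _)
  have h₃' : u' ≫ s.app _ = 𝟙 _ := hu' ▸ (x.u_s true).trans (res_refl B _)
  have h₄ : res B (inf_le_inf_right D.1 le_top) ≫ u' = u ≫ res Y (inf_le_inf_right D.1 le_top) :=
    hu ▸ hu' ▸ x.res_u (j := false) (j' := true) (by decide)
  have hD₁ : D.1 ≤ ⊤ ⊓ D.1 := le_inf le_top le_rfl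
  refine ⟨D, hD, u, res B hD₁ ≫ u' ≫ res Y inf_le_right, ⟨h₂, h₃, ?_⟩, ⟨?_, ?_, ?_⟩, h₁, ?_⟩
  · rw [← res_comp Y inf_le_left (le_top : T ≤ ⊤), ← assoc, h₁, assoc, hw.comp_res,
      res_comp_assoc]
  · rw [← res_naturality_assoc, ← assoc (f.app _), h₂', ← assoc, res_naturality, assoc, res_comp,
      res_refl, comp_id]
  · rw [assoc, assoc, res_naturality, ← assoc u', h₃', id_comp, res_comp, res_refl]
  · rw [assoc, assoc, res_comp, h₁', res_comp_assoc]
  · rw [res_comp_assoc, ← assoc, h₄, assoc, res_comp]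

lemma IsSection.exists_sup (hX : IsGood X) (hB : IsGood B) {T D : LowerSet R}
    {w : B.obj T ⟶ Y.obj T} {u' : B.obj D ⟶ Y.obj D} {u : B.obj (T ⊓ D) ⟶ Y.obj (T ⊓ D)}
    (hw : IsSection f g s v w) (hu' : IsSection f g s v u')
    (h : u ≫ res Y inf_le_left = res B inf_le_left ≫ w)
    (h' : u ≫ res Y inf_le_right = res B inf_le_right ≫ u') :
    ∃ w' : B.obj (T ⊔ D) ⟶ Y.obj (T ⊔ D), IsSection f g s v w' ∧
      w ≫ res Y le_sup_left = res B le_sup_left ≫ w' := by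
  have hc := hB.isPushout T D
  have e : res B inf_le_left ≫ w ≫ res Y (le_sup_left : T ≤ T ⊔ D) =
      res B inf_le_right ≫ u' ≫ res Y (le_sup_right : D ≤ T ⊔ D) := by
    rw [← assoc, ← h, ← assoc, ← h', assoc, assoc, res_comp, res_comp]
  have h₁ := hc.inl_desc _ _ e
  have h₂ := hc.inr_desc _ _ e
  refine ⟨hc.desc _ _ e, ⟨?_, ?_, ?_⟩, h₁.symm⟩
  · refine (hX.isPushout T D).hom_ext ?_ ?_
    · rw [res_naturality_assoc, h₁, ← assoc, hw.fac, res_naturality]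
    · rw [res_naturality_assoc, h₂, ← assoc, hu'.fac, res_naturality]
  · refine hc.hom_ext ?_ ?_
    · rw [← assoc, h₁, assoc, res_naturality, ← assoc, hw.comp_app, id_comp, comp_id]
    · rw [← assoc, h₂, assoc, res_naturality, ← assoc, hu'.comp_app, id_comp, comp_id]
  · refine hc.hom_ext ?_ ?_
    · rw [← assoc, h₁, assoc, res_comp, hw.comp_res, res_comp_assoc]
    · rw [← assoc, h₂, assoc, res_comp, hu'.comp_res, res_comp_assoc]

lemma exists_corner_lift_of_isSection {ι : Type v} {a b : ι → C} (S : ∀ i, a i ⟶ b i)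
    [HasPushouts C] (hX : IsGood X) (hY : IsGood Y) (hgs : g ≫ s = f)
    (hg : ∀ {E₁ E₂ : R ⥤ C} (η : E₁ ⟶ E₂), (∀ r, (MorphismProperty.ofHoms S).rlp (η.app r)) →
      HasLiftingProperty (Functor.whiskerLeft (iic R) g) η)
    {T T' : LowerSet R} (hT : T ≤ T') {u : B.obj T ⟶ Y.obj T} {u' : B.obj T' ⟶ Y.obj T'}
    (hu : IsSection f g s v u) (hu' : IsSection f g s v u') (h : u ≫ res Y hT = res B hT ≫ u')
    {P Q : C} (p : P ⟶ Q) (hp : (MorphismProperty.ofHoms S).rlp p)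
    (x : X.obj T' ⟶ P) (y : B.obj T ⟶ P) (z : B.obj T' ⟶ Q)
    (hxy : res X hT ≫ x = f.app T ≫ y) (hxz : f.app T' ≫ z = x ≫ p)
    (hyz : res B hT ≫ z = y ≫ p) :
    ∃ l : B.obj T' ⟶ P, f.app T' ≫ l = x ∧ res B hT ≫ l = y ∧ l ≫ p = z := by
  have hgs' (T : LowerSet R) : g.app T ≫ s.app T = f.app T := NatTrans.congr_app hgs T
  obtain ⟨l, h₁, h₂, h₃⟩ := hX.exists_corner_lift S hY hg hT p hp x (s.app T ≫ y) (s.app T' ≫ z)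
    (by rw [hxy, ← assoc, hgs']) (by rw [← assoc, hgs', hxz])
    (by rw [res_naturality_assoc, hyz, assoc])
  refine ⟨u' ≫ l, ?_, ?_, ?_⟩
  · rw [← assoc, hu'.fac, h₁]
  · rw [← assoc, ← h, assoc, h₂, ← assoc, hu.comp_app, id_comp]
  · rw [assoc, h₃, ← assoc, hu'.comp_app, id_comp]

end Step

section PushoutDiagram

variable {K : Type u} [Category.{v} K] {R : Type w} [PartialOrder R] {A B P : LowerSet R ⥤ K}

/-- The natural transformation from `A` to the constant diagram at its top value. -/
@[simps!]
def toTop (A : LowerSet R ⥤ K) : A ⟶ (Functor.const _).obj (A.obj ⊤) :=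
  mkNatTrans (Y := (Functor.const _).obj (A.obj ⊤)) (fun _ => res A le_top)
    fun _ _ h => (res_comp A h le_top).trans (comp_id _).symm

variable {f : A ⟶ B} {i : (Functor.const _).obj (A.obj ⊤) ⟶ P} {j : B ⟶ P}

lemma app_res {T T' : LowerSet R} (i : (Functor.const _).obj (A.obj ⊤) ⟶ P) (h : T ≤ T') :
    i.app T ≫ res P h = i.app T' :=
  (res_naturality i h).symm.trans (id_comp _)

lemma app_res_assoc {T T' : LowerSet R} (i : (Functor.const _).obj (A.obj ⊤) ⟶ P) (h : T ≤ T')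
    {Z : K} (a : P.obj T' ⟶ Z) : i.app T ≫ res P h ≫ a = i.app T' ≫ a := by
  rw [← assoc, app_res]

lemma isPushout_app [HasPushouts K] (hP : IsPushout (toTop A) f i j) (T : LowerSet R) :
    IsPushout (res A le_top) (f.app T) (i.app T) (j.app T) :=
  hP.map ((evaluation _ _).obj T)

/-- The corner map of `f` at an inequality `T ≤ T'`. -/
noncomputable abbrev corner [HasPushouts K] (f : A ⟶ B) {T T' : LowerSet R} (h : T ≤ T') :
    pushout (res A h) (f.app T) ⟶ B.obj T' :=
  pushout.desc (f.app T') (res B h) (res_naturality f h)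

lemma isPushout_corner [HasPushouts K] (hA : IsGood A) (hB : IsGood B)
    (hP : IsPushout (toTop A) f i j) (T D : LowerSet R) :
    ∃ m n, IsPushout (corner f (inf_le_right : T ⊓ D ≤ D)) m n
      (res P (le_sup_left : T ≤ T ⊔ D)) := by
  have hP (T : LowerSet R) := isPushout_app hP T
  have hw (T : LowerSet R) : res A le_top ≫ i.app T = f.app T ≫ j.app T := (hP T).w
  refine ⟨pushout.desc (res A le_top ≫ i.app T) (res B inf_le_left ≫ j.app T) ?_,
    res B le_sup_right ≫ j.app _, isPushout_of_exists ?_ (fun Z a b h h' => ?_)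
      fun Z a b h => ?_⟩
  · rw [res_comp_assoc, ← res_naturality_assoc, ← hw, res_comp_assoc]
  · ext
    · rw [pushout.inl_desc_assoc, pushout.inl_desc_assoc, ← res_naturality_assoc, ← hw,
        res_comp_assoc, assoc, app_res]
    · rw [pushout.inr_desc_assoc, pushout.inr_desc_assoc, res_comp_assoc, assoc,
        ← res_naturality, res_comp_assoc]
  · refine (hP _).hom_ext ?_ ?_
    · rw [← app_res i le_sup_left, assoc, h', assoc]
    · refine (hB.isPushout T D).hom_ext ?_ ?_
      · rw [res_naturality_assoc, h', res_naturality_assoc]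
      · simpa using h
  · have h₁ : f.app D ≫ a = res A le_top ≫ i.app T ≫ b := by
      simpa only [pushout.inl_desc_assoc, assoc] using congr_arg (pushout.inl _ _ ≫ ·) h
    have h₂ : res B inf_le_right ≫ a = res B inf_le_left ≫ j.app T ≫ b := by
      simpa only [pushout.inr_desc_assoc, assoc] using congr_arg (pushout.inr _ _ ≫ ·) h
    have h₃ := (hB.isPushout T D).inl_desc _ _ h₂.symm
    have h₄ := (hB.isPushout T D).inr_desc _ _ h₂.symm
    have h₅ : res A le_top ≫ i.app T ≫ b =
        f.app (T ⊔ D) ≫ (hB.isPushout T D).desc _ _ h₂.symm := by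
      refine (hA.isPushout T D).hom_ext ?_ ?_
      · rw [res_naturality_assoc, h₃, res_comp_assoc, ← assoc, hw, assoc]
      · rw [res_naturality_assoc, h₄, res_comp_assoc, h₁]
    have h₆ := (hP (T ⊔ D)).inl_desc _ _ h₅
    have h₇ := (hP (T ⊔ D)).inr_desc _ _ h₅
    refine ⟨(hP (T ⊔ D)).desc _ _ h₅, ?_, (hP T).hom_ext ?_ ?_⟩
    · rw [assoc, h₇, h₄]
    · rw [app_res_assoc, h₆]
    · rw [← res_naturality_assoc, h₇, h₃]

lemma isColimit_of_directed_of_isPushout [HasPushouts K] (hA : IsGood A) (hB : IsGood B)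
    (hP : IsPushout (toTop A) f i j) {I : Type*} [Preorder I] [IsDirectedOrder I] [Nonempty I]
    (φ : I ⥤ LowerSet R) (T : LowerSet R) (h : ∀ i, φ.obj i ≤ T)
    (hT : ∀ r ∈ T, ∃ i, r ∈ φ.obj i) : Nonempty (IsColimit (boundCocone P φ T h)) := by
  have hP (T : LowerSet R) := isPushout_app hP T
  have hw (T : LowerSet R) : res A le_top ≫ i.app T = f.app T ≫ j.app T := (hP T).w
  have hcA := (hA.isColimit_of_directed φ T h hT).some
  have hcB := (hB.isColimit_of_directed φ T h hT).some
  have extA {Z : K} {a b : A.obj T ⟶ Z} (e : ∀ i, res A (h i) ≫ a = res A (h i) ≫ b) : a = b :=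
    hcA.hom_ext e
  have extB {Z : K} {a b : B.obj T ⟶ Z} (e : ∀ i, res B (h i) ≫ a = res B (h i) ≫ b) : a = b :=
    hcB.hom_ext e
  obtain ⟨k₀⟩ := (inferInstance : Nonempty I)
  refine nonempty_isColimit (fun Z (a b : P.obj T ⟶ Z) hab => ?_) fun σ => ?_
  · have hab (k : I) : res P (h k) ≫ a = res P (h k) ≫ b := hab k
    refine (hP T).hom_ext ?_ (extB fun k => ?_)
    · rw [← app_res i (h k₀), assoc, assoc, hab]
    · rw [res_naturality_assoc, res_naturality_assoc, hab]
  · let τ (k : I) : P.obj (φ.obj k) ⟶ σ.pt := σ.ι.app k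
    have hτ {k l : I} (hkl : k ≤ l) : res P (leOfHom (φ.map (homOfLE hkl))) ≫ τ l = τ k :=
      σ.w (homOfLE hkl)
    have hi (k l : I) : i.app _ ≫ τ k = i.app _ ≫ τ l := by
      obtain ⟨m, hkm, hlm⟩ := exists_ge_ge k l
      rw [← hτ hkm, ← hτ hlm, app_res_assoc, app_res_assoc]
    obtain ⟨t, ht⟩ : ∃ t : B.obj T ⟶ σ.pt, ∀ k, res B (h k) ≫ t = j.app _ ≫ τ k :=
      ⟨hcB.desc (mkCocone (X := φ ⋙ B) (fun k => j.app _ ≫ τ k) fun k l hkl =>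
        (res_naturality_assoc j (leOfHom (φ.map (homOfLE hkl))) _).trans
          (congrArg (j.app _ ≫ ·) (hτ hkl))), fun k => hcB.fac _ k⟩
    have e : res A le_top ≫ i.app _ ≫ τ k₀ = f.app T ≫ t := extA fun k => by
      rw [res_naturality_assoc, ht, res_comp_assoc, hi k₀ k, ← assoc, hw, assoc]
    have h₁ := (hP T).inl_desc _ _ e
    have h₂ := (hP T).inr_desc _ _ e
    refine ⟨(hP T).desc _ _ e, fun k => ?_⟩
    change res P (h k) ≫ _ = τ k
    refine (hP _).hom_ext ?_ ?_
    · rw [app_res_assoc, h₁, hi k₀ k]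
    · rw [← res_naturality_assoc, h₂, ht]

lemma IsGood.isIso_of_bot [HasPushouts K] (hA : IsGood A) (hB : IsGood B)
    (hP : IsPushout (toTop A) f i j) : IsIso (i.app ⊥) := by
  have : IsIso (f.app ⊥) := by
    obtain ⟨a, -⟩ := hB.exists_desc (T := ⊥) (Z := A.obj ⊥) (fun r hr => hr.elim)
      fun r r' h hr => hr.elim
    exact ⟨a, hA.hom_ext fun r hr => hr.elim, hB.hom_ext fun r hr => hr.elim⟩
  exact (MorphismProperty.isomorphisms K).of_isPushout (isPushout_app hP ⊥) this

end PushoutDiagram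

section PartialSectionOrder

variable {C : Type u} [Category.{v} C] {R : Type v} [PartialOrder R] {X B Y : LowerSet R ⥤ C}

/-- The sections over lower sets which are compatible with `v`, ordered by extension. -/
@[ext]
structure LocalSection (f : X ⟶ B) (g : X ⟶ Y) (s : Y ⟶ B) (v : B.obj ⊤ ⟶ Y.obj ⊤) where
  support : LowerSet R
  w : B.obj support ⟶ Y.obj support
  isSection : IsSection f g s v w

variable {f : X ⟶ B} {g : X ⟶ Y} {s : Y ⟶ B} {v : B.obj ⊤ ⟶ Y.obj ⊤}

instance : PartialOrder (LocalSection f g s v) where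
  le x y := ∃ h : x.support ≤ y.support, x.w ≫ res Y h = res B h ≫ y.w
  le_refl x := ⟨le_rfl, by simp⟩
  le_trans x y z := fun ⟨h, e⟩ ⟨h', e'⟩ => ⟨h.trans h', by
    rw [← res_comp Y h h', ← assoc, e, assoc, e', res_comp_assoc]⟩
  le_antisymm := by
    rintro ⟨T, w, hw⟩ ⟨T', w', hw'⟩ ⟨h, e⟩ ⟨h', -⟩
    obtain rfl := le_antisymm h h'
    obtain rfl : w = w' := by simpa using e
    rfl

namespace LocalSection

/-- The support, as a functor. -/
abbrev supportFunctor (f : X ⟶ B) (g : X ⟶ Y) (s : Y ⟶ B) (v : B.obj ⊤ ⟶ Y.obj ⊤) :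
    LocalSection f g s v ⥤ LowerSet R :=
  Monotone.functor (f := LocalSection.support) fun _ _ h => h.1

lemma exists_support_eq_bot (hX : IsGood X) (hB : IsGood B) :
    ∃ x : LocalSection f g s v, x.support = ⊥ := by
  obtain ⟨w, -⟩ := hB.exists_desc (T := ⊥) (Z := Y.obj ⊥) (fun r hr => hr.elim)
    fun r r' h hr => hr.elim
  exact ⟨⟨⊥, w, hX.hom_ext fun r hr => hr.elim, hB.hom_ext fun r hr => hr.elim,
    hB.hom_ext fun r hr => hr.elim⟩, rfl⟩

lemma exists_lub (hX : IsGood X) (hB : IsGood B) {I : Type*} [LinearOrder I] [Nonempty I]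
    (φ : I ⥤ LocalSection f g s v) :
    ∃ (x : LocalSection f g s v) (_ : ∀ i, φ.obj i ≤ x), (∀ y, (∀ i, φ.obj i ≤ y) → x ≤ y) ∧
      ∀ r ∈ x.support, ∃ i, r ∈ (φ.obj i).support := by
  let T : LowerSet R := ⨆ i, (φ.obj i).support
  have h (i : I) : (φ.obj i).support ≤ T := le_iSup (fun i => (φ.obj i).support) i
  have hT (r : R) (hr : r ∈ T) : ∃ i, r ∈ (φ.obj i).support := LowerSet.mem_iSup_iff.1 hr
  have hmono {i j : I} (hij : i ≤ j) : φ.obj i ≤ φ.obj j := leOfHom (φ.map (homOfLE hij))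
  have hc := (hB.isColimit_of_directed (φ ⋙ supportFunctor f g s v) T h hT).some
  have extX {Z : C} {a b : X.obj T ⟶ Z} (e : ∀ i, res X (h i) ≫ a = res X (h i) ≫ b) : a = b :=
    (hX.isColimit_of_directed (φ ⋙ supportFunctor f g s v) T h hT).some.hom_ext e
  have extB {Z : C} {a b : B.obj T ⟶ Z} (e : ∀ i, res B (h i) ≫ a = res B (h i) ≫ b) : a = b :=
    hc.hom_ext e
  obtain ⟨w, hw⟩ : ∃ w : B.obj T ⟶ Y.obj T, ∀ i, res B (h i) ≫ w = (φ.obj i).w ≫ res Y (h i) :=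
    ⟨hc.desc (mkCocone (X := (φ ⋙ supportFunctor f g s v) ⋙ B)
      (fun i => (φ.obj i).w ≫ res Y (h i)) fun i j hij => by
        obtain ⟨h₁, h₂⟩ := hmono hij
        have : res B h₁ ≫ (φ.obj j).w ≫ res Y (h j) = (φ.obj i).w ≫ res Y (h i) := by
          rw [← assoc, ← h₂, assoc, res_comp]
        exact this), fun i => hc.fac _ i⟩
  refine ⟨⟨T, w, extX fun i => ?_, extB fun i => ?_, extB fun i => ?_⟩,
    fun i => ⟨h i, (hw i).symm⟩, fun y hy => ⟨iSup_le fun i => (hy i).1, extB fun i => ?_⟩, hT⟩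
  · rw [res_naturality_assoc, hw, ← assoc, (φ.obj i).isSection.fac, res_naturality]
  · rw [← assoc, hw, assoc, res_naturality, ← assoc, (φ.obj i).isSection.comp_app, id_comp,
      comp_id]
  · rw [← assoc, hw, assoc, res_comp, (φ.obj i).isSection.comp_res, res_comp_assoc]
  · rw [← assoc, hw, assoc, res_comp, res_comp_assoc, (hy i).2]

lemma exists_transfiniteCompositions (hX : IsGood X) (hB : IsGood B) (hY : IsGood Y)
    {κ : Cardinal.{v}} [Fact κ.IsRegular] (hκ₀ : Cardinal.aleph0 < κ)
    (hκ : ∀ r : R, HasCardinalLT (LowerSet.Iic r) κ)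
    (hX' : ∀ r, IsCardinalPresentable (X.obj (LowerSet.Iic r)) κ)
    (hB' : ∀ r, IsCardinalPresentable (B.obj (LowerSet.Iic r)) κ) (hv : IsSection f g s v v)
    {K : Type u'} [Category.{u''} K] (P : LowerSet R ⥤ K)
    (hP : ∀ {I : Type v} [LinearOrder I] [Nonempty I] (φ : I ⥤ LowerSet R) (T : LowerSet R)
      (h : ∀ i, φ.obj i ≤ T), (∀ r ∈ T, ∃ i, r ∈ φ.obj i) →
        Nonempty (IsColimit (boundCocone P φ T h)))
    (W : MorphismProperty K)
    (hW : ∀ (T D : LowerSet R) (u : B.obj (T ⊓ D) ⟶ Y.obj (T ⊓ D)) (u' : B.obj D ⟶ Y.obj D),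
      HasCardinalLT D κ → IsSection f g s v u → IsSection f g s v u' →
      u ≫ res Y inf_le_right = res B inf_le_right ≫ u' →
        W (res P (le_sup_left : T ≤ T ⊔ D))) :
    W.transfiniteCompositions.{v} (res P (bot_le : (⊥ : LowerSet R) ≤ ⊤)) := by
  have hnext (x : LocalSection f g s v) : ∃ (y : LocalSection f g s v) (h : x ≤ y),
      W (res P h.1) ∧ (y = x → x.support = ⊤) := by
    obtain ⟨D₀, hD₀⟩ : ∃ D₀ : SmallLowerSet R κ, D₀.1 ≤ x.support → x.support = ⊤ := by
      by_cases hx : x.support = ⊤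
      · exact ⟨Classical.arbitrary _, fun _ => hx⟩
      · obtain ⟨r, hr⟩ : ∃ r, r ∉ x.support := by
          by_contra! h
          exact hx (top_le_iff.1 fun r _ => h r)
        exact ⟨⟨LowerSet.Iic r, hκ r⟩, fun h => (hr (h (LowerSet.mem_Iic_iff.2 le_rfl))).elim⟩
    obtain ⟨D, hD, u, u', hu, hu', e, e'⟩ :=
      IsSection.exists_smallLowerSet hX hB hY hκ₀ hκ hX' hB' hv x.isSection D₀
    obtain ⟨w', hw', e''⟩ := x.isSection.exists_sup hX hB hu' e e'
    exact ⟨⟨x.support ⊔ D.1, w', hw'⟩, ⟨le_sup_left, e''⟩, hW _ _ u u' D.2 hu hu' e',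
      fun h => hD₀ (le_trans (b := D.1) hD (sup_eq_left.1 (congrArg support h)))⟩
  choose next h h₁ h₂ using hnext
  obtain ⟨x₀, hx₀⟩ := exists_support_eq_bot (f := f) (g := g) (s := s) (v := v) hX hB
  obtain ⟨x, hx, e, hP'⟩ := LeftInduced.exists_transfiniteCompositions
    (supportFunctor f g s v ⋙ P) W x₀ next h h₁ fun I _ _ φ => by
      obtain ⟨x, hx, hx', hx''⟩ := exists_lub hX hB φ
      exact ⟨x, hx, hx', hP (φ ⋙ supportFunctor f g s v) x.support (fun i => (hx i).1) hx''⟩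
  have hx' := h₂ x e
  obtain ⟨_, _, _, rfl, rfl, h⟩ : ∃ (T T' : LowerSet R) (h : T ≤ T'), T = ⊥ ∧ T' = ⊤ ∧
      W.transfiniteCompositions.{v} (res P h) := ⟨_, _, hx.1, hx₀, hx', hP'⟩
  exact h

end LocalSection

end PartialSectionOrder

section Cellular

variable {K : Type u} [Category.{v} K] {L : Type u'} [Category.{v} L] {R : Type v} [PartialOrder R]

lemma isCardinalPresentable_of_isPushout {κ : Cardinal.{v}} [Fact κ.IsRegular] {X Y Z P : K}
    {f : X ⟶ Y} {g : X ⟶ Z} {i : Y ⟶ P} {j : Z ⟶ P} (h : IsPushout f g i j)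
    (hX : IsCardinalPresentable X κ) (hY : IsCardinalPresentable Y κ)
    (hZ : IsCardinalPresentable Z κ) : IsCardinalPresentable P κ := by
  have (x : WalkingSpan) : IsCardinalPresentable ((span f g).obj x) κ := by
    obtain _ | _ | _ := x <;> assumption
  exact isCardinalPresentable_of_isColimit _ h.isColimit κ
    (hasCardinalLT_of_finite _ _ (Cardinal.IsRegular.aleph0_le Fact.out))

/-- The morphisms between `κ`-presentable objects which are sent by `F` to `W`. -/
def presentableInverseImage (κ : Cardinal.{v}) [Fact κ.IsRegular] (F : K ⥤ L)
    (W : MorphismProperty L) : MorphismProperty K :=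
  fun X Y f => IsCardinalPresentable X κ ∧ IsCardinalPresentable Y κ ∧ W (F.map f)

variable {A B : LowerSet R ⥤ K} {Y : LowerSet R ⥤ L}

lemma llp_map_corner {ι : Type v} {a b : ι → L} (S : ∀ i, a i ⟶ b i) [HasPushouts K]
    [HasPushouts L] (F : K ⥤ L) [PreservesColimitsOfShape WalkingSpan F] (f : A ⟶ B)
    {g : A ⋙ F ⟶ Y} {s : Y ⟶ B ⋙ F} {v : (B ⋙ F).obj ⊤ ⟶ Y.obj ⊤}
    (hA : IsGood (A ⋙ F)) (hY : IsGood Y) (hgs : g ≫ s = Functor.whiskerRight f F)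
    (hg : ∀ {E₁ E₂ : R ⥤ L} (η : E₁ ⟶ E₂), (∀ r, (MorphismProperty.ofHoms S).rlp (η.app r)) →
      HasLiftingProperty (Functor.whiskerLeft (iic R) g) η)
    {T T' : LowerSet R} (hT : T ≤ T') {u : (B ⋙ F).obj T ⟶ Y.obj T}
    {u' : (B ⋙ F).obj T' ⟶ Y.obj T'}
    (hu : IsSection (Functor.whiskerRight f F) g s v u)
    (hu' : IsSection (Functor.whiskerRight f F) g s v u')
    (h : u ≫ res Y hT = res (B ⋙ F) hT ≫ u') :
    (MorphismProperty.ofHoms S).rlp.llp (F.map (corner f hT)) := by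
  intro P Q p hp
  refine ⟨fun {x z} sq => ?_⟩
  have h₁ : F.map (pushout.inl _ _) ≫ F.map (corner f hT) = F.map (f.app T') := by
    rw [← F.map_comp, pushout.inl_desc]
  have h₂ : F.map (pushout.inr _ _) ≫ F.map (corner f hT) = F.map (res B hT) := by
    rw [← F.map_comp, pushout.inr_desc]
  have hc := (IsPushout.of_hasPushout (res A hT) (f.app T)).map F
  obtain ⟨l, hl₁, hl₂, hl₃⟩ := exists_corner_lift_of_isSection S hA hY hgs hg hT hu hu' h p hp
    (F.map (pushout.inl _ _) ≫ x) (F.map (pushout.inr _ _) ≫ x) z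
    ((assoc _ _ _).symm.trans ((congrArg (· ≫ x) hc.w).trans (assoc _ _ _)))
    ((congrArg (· ≫ z) h₁.symm).trans ((assoc _ _ _).trans
      ((congrArg (_ ≫ ·) sq.w.symm).trans (assoc _ _ _).symm)))
    ((congrArg (· ≫ z) h₂.symm).trans ((assoc _ _ _).trans
      ((congrArg (_ ≫ ·) sq.w.symm).trans (assoc _ _ _).symm)))
  exact CommSq.HasLift.mk' {
    l := l
    fac_left := hc.hom_ext
      ((assoc _ _ _).symm.trans ((congrArg (· ≫ l) h₁).trans hl₁))
      ((assoc _ _ _).symm.trans ((congrArg (· ≫ l) h₂).trans hl₂))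
    fac_right := hl₃ }

lemma IsGood.exists_isSection {ι : Type v} {a b : ι → L} (S : ∀ i, a i ⟶ b i)
    {X B Y : LowerSet R ⥤ L} {f : X ⟶ B} {g : X ⟶ Y} {s : Y ⟶ B} (hgs : g ≫ s = f)
    (hf : (MorphismProperty.ofHoms S).rlp.llp (f.app ⊤))
    (hs : (MorphismProperty.ofHoms S).rlp (s.app ⊤)) :
    ∃ v : B.obj ⊤ ⟶ Y.obj ⊤, IsSection f g s v v := by
  have sq : CommSq (g.app ⊤) (f.app ⊤) (s.app ⊤) (𝟙 _) :=
    ⟨(NatTrans.congr_app hgs ⊤).trans (comp_id _).symm⟩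
  have := hf _ hs
  exact ⟨sq.lift, sq.fac_left, sq.fac_right, by simp⟩

lemma IsGood.transfiniteCompositions_app_top {ι : Type v} {a b : ι → L} (S : ∀ i, a i ⟶ b i)
    [HasColimitsOfSize.{v, v} K] [HasColimitsOfSize.{v, v} L] [IsAccessibleCategory.{v} L]
    (F : K ⥤ L) [PreservesColimitsOfSize.{v, v} F] (κ : Cardinal.{v}) [Fact κ.IsRegular]
    (ha : ∀ i, IsCardinalPresentable (a i) κ) (hb : ∀ i, IsCardinalPresentable (b i) κ)
    [IsCardinalFiltered R κ] (hA : IsGood A) (hB : IsGood B) (f : A ⟶ B)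
    (lam : Cardinal.{v}) [Fact lam.IsRegular] (h₀ : Cardinal.aleph0 < lam)
    (hR : ∀ r : R, HasCardinalLT (LowerSet.Iic r) lam)
    (hA' : ∀ r, IsCardinalPresentable (A.obj (LowerSet.Iic r)) lam)
    (hB' : ∀ r, IsCardinalPresentable (B.obj (LowerSet.Iic r)) lam)
    (hFA : ∀ r, IsCardinalPresentable (F.obj (A.obj (LowerSet.Iic r))) lam)
    (hFB : ∀ r, IsCardinalPresentable (F.obj (B.obj (LowerSet.Iic r))) lam)
    (hf : (MorphismProperty.ofHoms S).rlp.llp (F.map (f.app ⊤))) :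
    (presentableInverseImage lam F
      (MorphismProperty.ofHoms S).rlp.llp).pushouts.transfiniteCompositions.{v} (f.app ⊤) := by
  have hFA' : IsGood (A ⋙ F) := hA.comp F
  have hFB' : IsGood (B ⋙ F) := hB.comp F
  obtain ⟨Y, hY, g, s, hgs, hg, hs⟩ := hFA'.exists_factorization S (Functor.whiskerRight f F)
  obtain ⟨v, hv⟩ := IsGood.exists_isSection S hgs hf (hY.rlp_app_top S hFB' s κ ha hb hs)
  obtain ⟨P, i, j, hP⟩ : ∃ (P : LowerSet R ⥤ K) (i : _ ⟶ P) (j : B ⟶ P),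
    IsPushout (toTop A) f i j := ⟨_, _, _, IsPushout.of_hasPushout _ _⟩
  have h := LocalSection.exists_transfiniteCompositions hFA' hFB' hY h₀ hR hFA hFB hv _
    (fun φ T h hT => isColimit_of_directed_of_isPushout hA hB hP φ T h hT)
    (presentableInverseImage lam F (MorphismProperty.ofHoms S).rlp.llp).pushouts
    fun T D u u' hD hu hu' e => by
      obtain ⟨m, n, hmn⟩ := isPushout_corner hA hB hP T D
      refine MorphismProperty.pushouts_mk _ hmn.flip ⟨?_, hB.isCardinalPresentable lam hB' _ hD,
        llp_map_corner S F f hFA' hY hgs hg _ hu hu' e⟩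
      have hTD := hasCardinalLT_inf T hD
      exact isCardinalPresentable_of_isPushout (IsPushout.of_hasPushout _ _)
        (hA.isCardinalPresentable lam hA' _ hTD) (hA.isCardinalPresentable lam hA' _ hD)
        (hB.isCardinalPresentable lam hB' _ hTD)
  have h₁ : IsIso (i.app ⊥) := hA.isIso_of_bot hB hP
  have h₂ := isPushout_app hP ⊤
  have h₃ : IsIso (j.app ⊤) := (MorphismProperty.isomorphisms K).of_isPushout h₂.flip
    (show IsIso (res A le_top) by rw [res_refl]; infer_instance)
  have e : f.app ⊤ ≫ j.app ⊤ = i.app ⊥ ≫ res P bot_le := by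
    rw [← h₂.w, res_refl, id_comp, app_res]
  rw [MorphismProperty.transfiniteCompositions_iff] at h ⊢
  obtain ⟨J, _, _, _, _, h⟩ := h
  exact ⟨J, _, _, _, _, (MorphismProperty.arrow_mk_iso_iff _
    (Arrow.isoMk (asIso (i.app ⊥)) (asIso (j.app ⊤)) e.symm)).2 h⟩

end Cellular

section Presentation

lemma exists_final_hasCardinalLT_Iic (α : Type w) [PartialOrder α] (κ lam : Cardinal.{w})
    [Fact κ.IsRegular] [IsCardinalFiltered α κ] (h : (2 : Cardinal) ^ κ < lam) :
    ∃ (R : Type w) (_ : PartialOrder R) (_ : IsCardinalFiltered R κ) (G : R ⥤ α),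
      G.Final ∧ ∀ r : R, HasCardinalLT (LowerSet.Iic r) lam := by
  have hκ : Cardinal.aleph0 ≤ κ := Cardinal.IsRegular.aleph0_le Fact.out
  let R := {σ : Set α // HasCardinalLT σ κ ∧ ∃ m, IsGreatest σ m}
  let m (σ : R) : α := σ.2.2.choose
  have hm (σ : R) : IsGreatest σ.1 (m σ) := σ.2.2.choose_spec
  have hR : IsCardinalFiltered R κ := isCardinalFiltered_preorder _ _ fun ι σ hι => by
    rw [← hasCardinalLT_iff_cardinal_mk_lt] at hι
    let t := IsCardinalFiltered.max (fun i => m (σ i)) hι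
    have ht (i : ι) : m (σ i) ≤ t := leOfHom (IsCardinalFiltered.toMax (fun i => m (σ i)) hι i)
    refine ⟨⟨(⋃ i, (σ i).1) ∪ {t}, hasCardinalLT_union hκ
      (hasCardinalLT_iUnion _ hι fun i => (σ i).2.1) (hasCardinalLT_of_finite _ _ hκ), t,
      by simp, ?_⟩, fun i => ?_⟩
    · rintro x (hx | rfl)
      · obtain ⟨i, hi⟩ := Set.mem_iUnion.1 hx
        exact ((hm (σ i)).2 hi).trans (ht i)
      · exact le_rfl
    · exact (Set.subset_iUnion (fun i => (σ i).1) i).trans Set.subset_union_left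
  have hG : Monotone m := fun σ τ h => (hm τ).2 (h (hm σ).1)
  have := isFiltered_of_isCardinalFiltered R κ
  refine ⟨R, inferInstance, hR, hG.functor, Functor.final_of_exists_of_isFiltered _
    (fun a => ⟨⟨{a}, hasCardinalLT_of_finite _ _ hκ, a, isGreatest_singleton⟩, ⟨homOfLE ?_⟩⟩)
    fun _ _ => ⟨_, 𝟙 _, Subsingleton.elim _ _⟩, fun σ => ?_⟩
  · exact (hm ⟨{a}, _⟩).2 rfl
  · refine HasCardinalLT.of_injective (X := Set σ.1) ?_
      (fun τ => {x | x.1 ∈ τ.1.1}) fun τ τ' hτ => ?_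
    · rw [hasCardinalLT_iff_cardinal_mk_lt, Cardinal.mk_set]
      have := σ.2.1
      rw [hasCardinalLT_iff_cardinal_mk_lt] at this
      exact (Cardinal.power_le_power_left two_ne_zero this.le).trans_lt h
    · refine Subtype.ext (Subtype.ext (Set.ext fun x => ⟨fun hx => ?_, fun hx => ?_⟩))
      · exact (Set.ext_iff.1 hτ ⟨x, τ.2 hx⟩).1 hx
      · exact (Set.ext_iff.1 hτ ⟨x, τ'.2 hx⟩).2 hx

lemma exists_colimitOfShape_hasCardinalLT_Iic {C : Type u} [Category.{v} C]
    {P : ObjectProperty C} {κ : Cardinal.{w}} [Fact κ.IsRegular]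
    (hP : P.IsCardinalFilteredGenerator κ) {lam : Cardinal.{w}} (h : (2 : Cardinal) ^ κ < lam)
    (X : C) :
    ∃ (R : Type w) (_ : PartialOrder R) (_ : IsCardinalFiltered R κ),
      P.colimitsOfShape R X ∧ ∀ r : R, HasCardinalLT (LowerSet.Iic r) lam := by
  obtain ⟨J, _, _, ⟨p⟩⟩ := hP.exists_colimitsOfShape X
  obtain ⟨α, _, _, G, _⟩ := IsCardinalFiltered.exists_cardinal_directed J κ
  obtain ⟨R, _, _, G', _, hR⟩ := exists_final_hasCardinalLT_Iic α κ lam h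
  exact ⟨R, inferInstance, inferInstance, ⟨(p.reindex G).reindex G'⟩, hR⟩

lemma IsGood.exists_arrow_iso {C : Type u} [Category.{v} C] {R : Type w} [PartialOrder R]
    [IsDirectedOrder R] {A B : LowerSet R ⥤ C} (hA : IsGood A) (hB : IsGood B)
    {D₀ D₁ : R ⥤ C} (δ : D₀ ⟶ D₁) (eA : iic R ⋙ A ≅ D₀) (eB : iic R ⋙ B ≅ D₁)
    {c₀ : Cocone D₀} {c₁ : Cocone D₁} (hc₀ : IsColimit c₀) (hc₁ : IsColimit c₁)
    (f : c₀.pt ⟶ c₁.pt) (hf : ∀ r, c₀.ι.app r ≫ f = δ.app r ≫ c₁.ι.app r) :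
    ∃ φ : A ⟶ B, Nonempty (Arrow.mk (φ.app ⊤) ≅ Arrow.mk f) := by
  let a (r : R) : A.obj (LowerSet.Iic r) ≅ D₀.obj r := eA.app r
  let b (r : R) : B.obj (LowerSet.Iic r) ≅ D₁.obj r := eB.app r
  obtain ⟨φ, hφ⟩ := hA.exists_natTrans B
    (fun r => (a r).hom ≫ δ.app r ≫ (b r).inv) fun r r' h => by
      have := (eA.hom ≫ δ ≫ eB.inv).naturality (homOfLE h)
      exact this
  obtain ⟨hA'⟩ := hA.isColimit_of_directed (iic R) ⊤ (fun _ => le_top)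
    fun r _ => ⟨r, LowerSet.mem_Iic_iff.2 le_rfl⟩
  obtain ⟨hB'⟩ := hB.isColimit_of_directed (iic R) ⊤ (fun _ => le_top)
    fun r _ => ⟨r, LowerSet.mem_Iic_iff.2 le_rfl⟩
  let iA : A.obj ⊤ ≅ c₀.pt := hA'.coconePointsIsoOfNatIso hc₀ eA
  let iB : B.obj ⊤ ≅ c₁.pt := hB'.coconePointsIsoOfNatIso hc₁ eB
  have hiA (r : R) : res A (p := LowerSet.Iic r) le_top ≫ iA.hom = (a r).hom ≫ c₀.ι.app r :=
    hA'.comp_coconePointsIsoOfNatIso_hom hc₀ eA r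
  have hiB (r : R) : res B (p := LowerSet.Iic r) le_top ≫ iB.hom = (b r).hom ≫ c₁.ι.app r :=
    hB'.comp_coconePointsIsoOfNatIso_hom hc₁ eB r
  refine ⟨φ, ⟨Arrow.isoMk iA iB (hA'.hom_ext fun r => ?_)⟩⟩
  change res A (p := LowerSet.Iic r) le_top ≫ iA.hom ≫ f =
    res A (p := LowerSet.Iic r) le_top ≫ φ.app ⊤ ≫ iB.hom
  rw [reassoc_of% hiA, res_naturality_assoc, hφ, hiB, hf]
  simp

lemma exists_isGood_arrow {C : Type u} [Category.{v} C] [HasColimitsOfSize.{w, w} C]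
    {P : ObjectProperty (ComposableArrows C 1)} {κ : Cardinal.{w}} [Fact κ.IsRegular]
    (hP : P.IsCardinalFilteredGenerator κ) {lam : Cardinal.{w}} (h : (2 : Cardinal) ^ κ < lam)
    {X Y : C} (f : X ⟶ Y) :
    ∃ (R : Type w) (_ : PartialOrder R) (_ : IsCardinalFiltered R κ)
      (A B : LowerSet R ⥤ C) (φ : A ⟶ B), IsGood A ∧ IsGood B ∧
      Nonempty (Arrow.mk (φ.app ⊤) ≅ Arrow.mk f) ∧
      (∀ r : R, HasCardinalLT (LowerSet.Iic r) lam) ∧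
      ∀ r : R, ∃ G, P G ∧ Nonempty (G.obj 0 ≅ A.obj (LowerSet.Iic r)) ∧
        Nonempty (G.obj 1 ≅ B.obj (LowerSet.Iic r)) := by
  obtain ⟨R, _, _, ⟨p⟩, hR⟩ :=
    exists_colimitOfShape_hasCardinalLT_Iic hP h (ComposableArrows.mk₁ f)
  have := isFiltered_of_isCardinalFiltered R κ
  have : IsDirectedOrder R := IsFiltered.isDirectedOrder _
  let ev (i : Fin 2) : ComposableArrows C 1 ⥤ C := (evaluation (Fin 2) C).obj i
  obtain ⟨A, hA, ⟨eA⟩⟩ := exists_isGood (p.diag ⋙ ev 0)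
  obtain ⟨B, hB, ⟨eB⟩⟩ := exists_isGood (p.diag ⋙ ev 1)
  let hom : (0 : Fin 2) ⟶ 1 := homOfLE (by simp)
  obtain ⟨φ, e⟩ := hA.exists_arrow_iso hB
    (Functor.whiskerLeft p.diag ((evaluation (Fin 2) C).map hom)) eA eB
    (isColimitOfPreserves (ev 0) p.isColimit) (isColimitOfPreserves (ev 1) p.isColimit) f
    fun r => ((p.ι.app r).naturality hom).symm
  exact ⟨R, inferInstance, inferInstance, A, B, φ, hA, hB, e, hR, fun r =>
    ⟨_, p.prop_diag_obj r, ⟨(eA.app r).symm⟩, ⟨(eB.app r).symm⟩⟩⟩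

end Presentation

section Main

variable {K : Type u} {L : Type u'} [Category.{v} K] [Category.{v} L]

lemma pushouts_transfiniteCompositions_of_presentable [IsLocallyPresentable.{v} K]
    [HasColimitsOfSize.{v, v} L] [IsAccessibleCategory.{v} L]
    {ι : Type v} {a b : ι → L} (S : ∀ i, a i ⟶ b i)
    (F : K ⥤ L) [PreservesColimitsOfSize.{v, v} F] :
    ∃ (lam : Cardinal.{v}) (_ : Fact lam.IsRegular) (_ : IsCardinalLocallyPresentable K lam),
      ∀ ⦃X Y : K⦄ (f : X ⟶ Y), (MorphismProperty.ofHoms S).rlp.llp (F.map f) →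
        (presentableInverseImage lam F
          (MorphismProperty.ofHoms S).rlp.llp).pushouts.transfiniteCompositions.{v} f := by
  obtain ⟨κ₀, _, _⟩ := IsLocallyPresentable.exists_cardinal.{v} K
  obtain ⟨κ, _, hκ₀, hκ⟩ := exists_isCardinalPresentable_forall (Sum.elim a b) κ₀
  have : IsCardinalLocallyPresentable K κ := .of_le _ hκ₀
  have := isCardinalLocallyPresentable_composableArrows (C := K) 1 κ
  obtain ⟨P, _, hP⟩ := HasCardinalFilteredGenerator.exists_small_generator
    (ComposableArrows K 1) κ
  let G (i : Shrink.{v} (Subtype P)) : ComposableArrows K 1 := ((equivShrink _).symm i).1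
  obtain ⟨lam₁, _, hlam₁, h₁⟩ := exists_isCardinalPresentable_forall
    (fun i : Shrink.{v} (Subtype P) × Fin 2 => (G i.1).obj i.2) (Order.succ (2 ^ κ))
  obtain ⟨lam, _, hlam, h₂⟩ := exists_isCardinalPresentable_forall
    (fun i : Shrink.{v} (Subtype P) × Fin 2 => F.obj ((G i.1).obj i.2)) lam₁
  have hlt : 2 ^ κ < lam := Order.succ_le_iff.1 (hlam₁.trans hlam)
  have hκlam : κ < lam := (Cardinal.cantor κ).trans hlt
  refine ⟨lam, inferInstance, .of_le _ hκlam.le, fun X Y f hf => ?_⟩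
  have hG {Z : K} (i : Fin 2) (Q) (hQ : P Q) (e : Q.obj i ≅ Z) :
      IsCardinalPresentable Z lam ∧ IsCardinalPresentable (F.obj Z) lam := by
    have h₁' := h₁ (equivShrink _ ⟨Q, hQ⟩, i)
    have h₂' := h₂ (equivShrink _ ⟨Q, hQ⟩, i)
    simp only [G, Equiv.symm_apply_apply] at h₁' h₂'
    have := isCardinalPresentable_of_le (Q.obj i) hlam
    exact ⟨isCardinalPresentable_of_iso e lam, isCardinalPresentable_of_iso (F.mapIso e) lam⟩
  obtain ⟨R, _, _, A, B, φ, hA, hB, ⟨e⟩, hR, hAB⟩ := exists_isGood_arrow hP hlt f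
  replace hf : (MorphismProperty.ofHoms S).rlp.llp (F.map (φ.app ⊤)) :=
    (MorphismProperty.arrow_mk_iso_iff _ (F.mapArrow.mapIso e)).2 hf
  choose Q hQ hQA hQB using hAB
  have := hA.transfiniteCompositions_app_top S F κ (fun i => hκ (.inl i)) (fun i => hκ (.inr i))
    hB φ lam ((Cardinal.IsRegular.aleph0_le Fact.out).trans_lt hκlam) hR
    (fun r => (hG 0 _ (hQ r) (hQA r).some).1) (fun r => (hG 1 _ (hQ r) (hQB r).some).1)
    (fun r => (hG 0 _ (hQ r) (hQA r).some).2) (fun r => (hG 1 _ (hQ r) (hQB r).some).2) hf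
  rw [MorphismProperty.transfiniteCompositions_iff] at this ⊢
  obtain ⟨J, _, _, _, _, h⟩ := this
  exact ⟨J, _, _, _, _, (MorphismProperty.arrow_mk_iso_iff _ e).1 h⟩

lemma isCellular_inverseImage {W : MorphismProperty L} (hW : CellularPaper.IsCellular W)
    (F : K ⥤ L) [PreservesColimitsOfSize.{v, v} F] :
    CellularPaper.IsCellular (W.inverseImage F) where
  isos _ _ := hW.isos _ inferInstance
  pushout sq hf := hW.pushout (sq.map F) hf
  transfinite f hf := hW.transfinite _ (by
    rw [isTransfiniteCompositionOf_eq, MorphismProperty.transfiniteCompositions_iff] at hf ⊢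
    obtain ⟨J, _, _, _, _, h⟩ := hf
    have : PreservesWellOrderContinuousOfShape J F := ⟨fun _ _ => inferInstance⟩
    exact ⟨J, _, _, _, _,
      MorphismProperty.transfiniteCompositionsOfShape_map_of_preserves _ F f h⟩)

lemma retracts_inverseImage_le {W : MorphismProperty L} (hW : CellularPaper.retracts W ≤ W)
    (F : K ⥤ L) : CellularPaper.retracts (W.inverseImage F) ≤ W.inverseImage F := by
  rw [retracts_eq, ← MorphismProperty.isStableUnderRetracts_iff_retracts_le] at hW ⊢
  infer_instance

lemma exists_presentableInverseImage_le (lam : Cardinal.{v}) [Fact lam.IsRegular]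
    [IsCardinalLocallyPresentable K lam] (F : K ⥤ L) (W : MorphismProperty L) [W.RespectsIso] :
    ∃ (ι : Type v) (a b : ι → K) (s : ∀ i, a i ⟶ b i), (∀ i, W (F.map (s i))) ∧
      presentableInverseImage lam F W ≤ CellularPaper.ofFamily s := by
  obtain ⟨P, _, -, hP⟩ := ObjectProperty.EssentiallySmall.exists_small_le.{v}
    (isCardinalPresentable K lam)
  let G (i : Shrink.{v} (Subtype P)) : K := ((equivShrink _).symm i).1
  have hG {X : K} (hX : IsCardinalPresentable X lam) : ∃ i, Nonempty (X ≅ G i) := by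
    obtain ⟨Y, hY, ⟨e⟩⟩ := hP X hX
    exact ⟨equivShrink _ ⟨Y, hY⟩, ⟨e ≪≫ eqToIso (by simp [G])⟩⟩
  refine ⟨Σ i j, {h : G i ⟶ G j // W (F.map h)}, fun t => G t.1, fun t => G t.2.1,
    fun t => t.2.2.1, fun t => t.2.2.2, ?_⟩
  rintro X Y f ⟨hX, hY, hf⟩
  obtain ⟨i, ⟨e⟩⟩ := hG hX
  obtain ⟨j, ⟨e'⟩⟩ := hG hY
  have iso : Arrow.mk f ≅ Arrow.mk (e.inv ≫ f ≫ e'.hom) := Arrow.isoMk e e' (by simp)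
  exact ⟨⟨i, j, e.inv ≫ f ≫ e'.hom,
    (MorphismProperty.arrow_mk_iso_iff W (F.mapArrow.mapIso iso)).1 hf⟩, ⟨iso⟩⟩

lemma isCofibrantlyGenerated_inverseImage [IsLocallyPresentable.{v} K]
    [HasColimitsOfSize.{v, v} L] [IsAccessibleCategory.{v} L] {W : MorphismProperty L}
    (hW : CellularPaper.IsCellular W) (hW' : CellularPaper.retracts W ≤ W)
    (hW'' : CellularPaper.IsCofibrantlyGenerated W)
    (F : K ⥤ L) [PreservesColimitsOfSize.{v, v} F] :
    CellularPaper.IsCofibrantlyGenerated (W.inverseImage F) := by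
  obtain ⟨ι, a, b, S, hS⟩ := hW''
  have h₁ := isCellular_inverseImage hW F
  have h₂ := retracts_inverseImage_le hW' F
  obtain rfl := eq_llp_rlp hW hW' S hS
  obtain ⟨lam, _, _, h⟩ := pushouts_transfiniteCompositions_of_presentable S F
  obtain ⟨ι', a', b', s, hs, hle⟩ := exists_presentableInverseImage_le lam F
    (MorphismProperty.ofHoms S).rlp.llp
  refine ⟨ι', a', b', s, le_antisymm (fun X Y f hf => ?_) ?_⟩
  · rw [cofClosure_eq]
    exact MorphismProperty.le_retracts _ _ (MorphismProperty.transfiniteCompositions_monotone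
      (MorphismProperty.pushouts_monotone hle) _ (h f hf))
  · rw [CellularPaper.cofClosure]
    rintro X Y f ⟨X', Y', g, hg, hfg⟩
    refine h₂ _ ⟨X', Y', g, h₁.transfinite g ?_, hfg⟩
    rw [isTransfiniteCompositionOf_eq] at hg ⊢
    refine MorphismProperty.transfiniteCompositions_monotone ?_ _ hg
    rintro X Y f ⟨A, B, k, u, v, ⟨i, ⟨e⟩⟩, sq⟩
    exact h₁.pushout sq ((MorphismProperty.arrow_mk_iso_iff
      (MorphismProperty.ofHoms S).rlp.llp (F.mapArrow.mapIso e)).2 (hs i))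

end Main

end LeftInduced

namespace CellularPaper

/-- left-induced combinatorial structures exist. If `F : K ⥤ L` preserves
colimits, `K` is locally presentable and `L` is combinatorial, then
`{f : F f is a cofibration}` is cellular, retract-closed and cofibrantly generated by a
set; i.e. it makes `K` combinatorial. -/
theorem left_induced_combinatorial {K : Type u} {L : Type u'}
    [Category.{v} K] [Category.{v} L]
    (hK : LocallyPresentable K)
    (CL : MorphismProperty L) (hL : IsCombinatorial L CL)
    (F : K ⥤ L) [PreservesColimits F] :
    IsCombinatorial K (fun _ _ f => CL (F.map f)) := by
  obtain ⟨κ, hκ⟩ := hK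
  obtain ⟨κ', hκ'⟩ := hL.locallyPresentable
  have : Fact κ.IsRegular := ⟨hκ.regular⟩
  have : Fact κ'.IsRegular := ⟨hκ'.regular⟩
  have := LeftInduced.isCardinalLocallyPresentable_of_isLocallyPresentable hκ
  have := LeftInduced.isCardinalLocallyPresentable_of_isLocallyPresentable hκ'
  have : CategoryTheory.IsLocallyPresentable.{v} K := ⟨κ, inferInstance, inferInstance⟩
  have : CategoryTheory.IsLocallyPresentable.{v} L := ⟨κ', inferInstance, inferInstance⟩
  have := hκ'.hasColimits
  exact
    { locallyPresentable := ⟨κ, hκ⟩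
      cellular := LeftInduced.isCellular_inverseImage hL.cellular F
      retractClosed := LeftInduced.retracts_inverseImage_le hL.retractClosed F
      cofibrantlyGenerated := LeftInduced.isCofibrantlyGenerated_inverseImage hL.cellular
        hL.retractClosed hL.cofibrantlyGenerated F }

end CellularPaper
end

section
/- In the category of simplicial sets, a morphism belongs to cof({t}), where t: 0 → 1 is the unique map from the empty simplicial set to the terminal simplicial set, if and only if it is isomorphic to a coproduct injection K → K ⨿ D where D is a discrete simplicial set. -/
open CategoryTheory Category Limits Opposite

universe w v u u' u''

namespace CellularPaper

variable {K : Type u} [Category.{v} K]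

lemma cofClosure_le_llp_rlp (X : MorphismProperty K) : cofClosure X ≤ X.rlp.llp := by
  rintro A B f ⟨X', Y', g, hg, u, v, r, s, h₁, h₂, h₃, h₄⟩
  refine MorphismProperty.of_retract (g := g)
    { i := Arrow.homMk u v h₁
      r := Arrow.homMk r s h₂
      retract := by ext <;> simp [h₃, h₄] } ?_
  obtain ⟨J, _, _, _, _, F, c, hc, eA, eB, hsucc, hlim, rfl⟩ := hg
  have : F.IsWellOrderContinuous := ⟨fun j hj => hlim j hj⟩
  have key : X.rlp.llp (c.ι.app ⊥) := fun _ _ p hp =>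
    HasLiftingProperty.transfiniteComposition.hasLiftingProperty_ι_app_bot
      (hc := hc) fun j hj => by
        obtain ⟨_, _, _, _, _, hi, sq⟩ := hsucc j hj
        exact (MorphismProperty.of_isPushout sq.flip (X.le_llp_rlp _ hi)) p hp
  exact (MorphismProperty.cancel_left_of_respectsIso _ _ _).2
    ((MorphismProperty.cancel_right_of_respectsIso _ _ _).2 key)

section DiscreteExtension

open Simplicial

/-- The `n`-simplex of `B` which is constant at the vertex `v`. -/
abbrev constSimplex {B : SSet.{u}} (n : SimplexCategoryᵒᵖ) (v : B _⦋0⦌) : B.obj n :=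
  B.map (n.unop.const ⦋0⦌ 0).op v

lemma map_constSimplex {B : SSet.{u}} {n m : SimplexCategoryᵒᵖ} (φ : n ⟶ m) (v : B _⦋0⦌) :
    B.map φ (constSimplex n v) = constSimplex m v := by
  dsimp [constSimplex]
  rw [← CategoryTheory.comp_apply, ← Functor.map_comp]
  rfl

lemma app_constSimplex {A B : SSet.{u}} (f : A ⟶ B) (n : SimplexCategoryᵒᵖ) (v : A _⦋0⦌) :
    f.app n (constSimplex n v) = constSimplex n (f.app _ v) :=
  NatTrans.naturality_apply f _ v

lemma constSimplex_injective {B : SSet.{u}} (n : SimplexCategoryᵒᵖ) :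
    Function.Injective (constSimplex (B := B) n) := by
  intro v w h
  have key (v : B _⦋0⦌) :
      B.map (SimplexCategory.const ⦋0⦌ n.unop 0).op (constSimplex n v) = v := by
    rw [map_constSimplex]
    have : (SimplexCategory.const ⦋0⦌ ⦋0⦌ 0) = 𝟙 _ := Subsingleton.elim _ _
    dsimp [constSimplex]
    rw [this]
    simp
  rw [← key v, ← key w, h]

/-- A simplicial set is discrete if all of its simplices are constant. -/
def IsDiscrete (D : SSet.{u}) : Prop :=
  ∀ (n : SimplexCategoryᵒᵖ) (x : D.obj n), ∃ v : D _⦋0⦌, constSimplex n v = x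

lemma IsDiscrete.of_iso {D E : SSet.{u}} (e : D ≅ E) (hE : IsDiscrete E) : IsDiscrete D := by
  intro n x
  obtain ⟨v, hv⟩ := hE n (e.hom.app n x)
  refine ⟨e.inv.app _ v, ?_⟩
  rw [← app_constSimplex, hv]
  exact ConcreteCategory.congr_hom (NatTrans.congr_app e.hom_inv_id n) x

lemma isDiscrete_sigma (S : Type u) : IsDiscrete (∐ fun _ : S => (Δ[0] : SSet.{u})) := by
  intro n x
  obtain ⟨⟨s⟩, y, rfl⟩ := Types.jointly_surjective_of_isColimit
    (isColimitOfPreserves ((evaluation _ _).obj n)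
      (colimit.isColimit (Discrete.functor fun _ : S => (Δ[0] : SSet.{u})))) x
  refine ⟨(Sigma.ι (fun _ : S => (Δ[0] : SSet.{u})) s).app _
    (constSimplex _ (SSet.stdSimplex.obj₀Equiv.symm 0)), ?_⟩
  rw [← app_constSimplex]
  dsimp
  congr 1
  exact SSet.stdSimplex.objEquiv.injective (Subsingleton.elim _ _)

/-- The coproduct of copies of `Δ[0]` indexed by the vertices of a discrete simplicial set. -/
noncomputable def IsDiscrete.isColimit {D : SSet.{u}} (hD : IsDiscrete D) :
    IsColimit (Cofan.mk D fun v : D _⦋0⦌ => (SSet.const v : Δ[0] ⟶ D)) := by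
  refine evaluationJointlyReflectsColimits _ fun n => ?_
  refine (isColimitMapCoconeCofanMkEquiv ((evaluation _ _).obj n) _ _).symm
    (Nonempty.some ?_)
  rw [Cofan.nonempty_isColimit_iff_bijective_fromSigma]
  have pt : Δ[0].obj n := constSimplex n (SSet.stdSimplex.obj₀Equiv.symm 0)
  refine ⟨?_, fun x => ?_⟩
  · rintro ⟨v, x⟩ ⟨w, y⟩ h
    obtain rfl : v = w := constSimplex_injective n h
    obtain rfl : x = y := SSet.stdSimplex.objEquiv.injective (Subsingleton.elim _ _)
    rfl
  · obtain ⟨v, rfl⟩ := hD n x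
    exact ⟨⟨v, pt⟩, rfl⟩

/-- A morphism of simplicial sets is a discrete extension if it is injective and if the
simplices which are not in its image form a discrete subcomplex of its codomain. -/
structure IsDiscreteExtension {A B : SSet.{u}} (f : A ⟶ B) : Prop where
  injective (n : SimplexCategoryᵒᵖ) : Function.Injective (f.app n)
  mem_range_of_map {n m : SimplexCategoryᵒᵖ} (φ : n ⟶ m) (b : B.obj n) :
    B.map φ b ∈ Set.range (f.app m) → b ∈ Set.range (f.app n)
  exists_vertex (n : SimplexCategoryᵒᵖ) (b : B.obj n) :
    b ∉ Set.range (f.app n) → ∃ v : B _⦋0⦌, constSimplex n v = b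

lemma isDiscreteExtension_coprod_inl {X D : SSet.{u}} (hD : IsDiscrete D) :
    IsDiscreteExtension (coprod.inl : X ⟶ X ⨿ D) := by
  have key (n : SimplexCategoryᵒᵖ) := (Types.binaryCofan_isColimit_iff _).1
    ⟨mapIsColimitOfPreservesOfIsColimit ((evaluation _ _).obj n) _ _ (coprodIsCoprod X D)⟩
  dsimp at key
  have key' (n : SimplexCategoryᵒᵖ) (b : (X ⨿ D).obj n) :
      b ∉ Set.range ((coprod.inl : X ⟶ X ⨿ D).app n) ↔
      b ∈ Set.range ((coprod.inr : D ⟶ X ⨿ D).app n) := by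
    have := (key n).2.2.compl_eq
    rw [← Set.mem_compl_iff]
    exact iff_of_eq (congrArg (b ∈ ·) this)
  refine ⟨fun n => (key n).1, fun {n m} φ b => ?_, fun n b hb => ?_⟩
  · rw [← not_imp_not, key', key']
    rintro ⟨d, rfl⟩
    exact ⟨D.map φ d, NatTrans.naturality_apply (coprod.inr : D ⟶ X ⨿ D) φ d⟩
  · obtain ⟨d, rfl⟩ := (key' _ _).1 hb
    obtain ⟨v, rfl⟩ := hD _ d
    exact ⟨_, (app_constSimplex _ _ _).symm⟩

lemma IsRetractOf.isDiscreteExtension {A B X Y : SSet.{u}} {f : A ⟶ B} {g : X ⟶ Y}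
    (h : IsRetractOf f g) (hg : IsDiscreteExtension g) : IsDiscreteExtension f := by
  obtain ⟨u, v, r, s, h₁, h₂, h₃, h₄⟩ := h
  have h₁' (n) (a : A.obj n) : g.app n (u.app n a) = v.app n (f.app n a) :=
    ConcreteCategory.congr_hom (NatTrans.congr_app h₁ n) a
  have h₂' (n) (x : X.obj n) : f.app n (r.app n x) = s.app n (g.app n x) :=
    ConcreteCategory.congr_hom (NatTrans.congr_app h₂ n) x
  have h₃' (n) (a : A.obj n) : r.app n (u.app n a) = a :=
    ConcreteCategory.congr_hom (NatTrans.congr_app h₃ n) a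
  have h₄' (n) (b : B.obj n) : s.app n (v.app n b) = b :=
    ConcreteCategory.congr_hom (NatTrans.congr_app h₄ n) b
  have mem {n} {b : B.obj n} (hb : v.app n b ∈ Set.range (g.app n)) :
      b ∈ Set.range (f.app n) := by
    obtain ⟨x, hx⟩ := hb
    exact ⟨r.app n x, by rw [h₂', hx, h₄']⟩
  refine ⟨fun n a a' haa => ?_, fun {n m} φ b hb => ?_, fun n b hb => ?_⟩
  · rw [← h₃' n a, ← h₃' n a', hg.injective n
      ((h₁' n a).trans ((congrArg _ haa).trans (h₁' n a').symm))]
  · obtain ⟨a, ha⟩ := hb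
    refine mem (hg.mem_range_of_map φ _ ⟨u.app m a, ?_⟩)
    rw [h₁', ha]
    exact NatTrans.naturality_apply v φ b
  · obtain ⟨y, hy⟩ := hg.exists_vertex n (v.app n b) (fun h => hb (mem h))
    exact ⟨s.app _ y, by rw [← app_constSimplex, hy, h₄']⟩

/-- The class of morphisms isomorphic to `∅ ⟶ Δ[0]`. -/
def emptyToPoint : MorphismProperty SSet.{u} :=
  fun _ _ i => Nonempty (Arrow.mk i ≅ Arrow.mk (initial.to (Δ[0] : SSet.{u})))

lemma ofFamily_emptyToPoint :
    ofFamily (fun _ : PUnit.{w + 1} => initial.to (Δ[0] : SSet.{u})) = emptyToPoint := by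
  ext
  exact ⟨fun ⟨_, h⟩ => h, fun h => ⟨⟨⟩, h⟩⟩

lemma rlp_emptyToPoint {X Y : SSet.{u}} (p : X ⟶ Y) (hp : Function.Surjective (p.app (op ⦋0⦌))) :
    emptyToPoint.rlp p := by
  rintro E F i ⟨e⟩
  rw [HasLiftingProperty.iff_of_arrow_iso_left e]
  refine ⟨fun {t b} sq => ?_⟩
  obtain ⟨x, hx⟩ := hp (SSet.yonedaEquiv b)
  refine ⟨⟨SSet.const x, Subsingleton.elim _ _, ?_⟩⟩
  apply SSet.yonedaEquiv.injective
  rw [SSet.yonedaEquiv_comp, SSet.yonedaEquiv_const, hx]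

lemma isDiscreteExtension_of_cofClosure {A B : SSet.{u}} {f : A ⟶ B}
    (hf : cofClosure emptyToPoint f) : IsDiscreteExtension f := by
  let p : A ⨿ (∐ fun _ : B _⦋0⦌ => (Δ[0] : SSet.{u})) ⟶ B :=
    coprod.desc f (Sigma.desc fun v => SSet.const v)
  have hp : Function.Surjective (p.app (op ⦋0⦌)) := fun v => by
    have : (Sigma.ι (fun _ : B _⦋0⦌ => (Δ[0] : SSet.{u})) v ≫ coprod.inr) ≫ p =
        SSet.const v := by
      rw [assoc, coprod.inr_desc, Sigma.ι_desc]
    have h := ConcreteCategory.congr_hom (NatTrans.congr_app this (op ⦋0⦌))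
      (SSet.stdSimplex.obj₀Equiv.symm 0)
    exact ⟨_, h.trans (SSet.yonedaEquiv_const v)⟩
  have := cofClosure_le_llp_rlp _ f hf p (rlp_emptyToPoint p hp)
  have fac : coprod.inl ≫ p = f := coprod.inl_desc _ _
  have sq : CommSq coprod.inl f p (𝟙 B) := ⟨by rw [fac, comp_id]⟩
  exact IsRetractOf.isDiscreteExtension
    ⟨𝟙 A, sq.lift, 𝟙 A, p, by simp, by simp [fac], by simp, by simp⟩
    (isDiscreteExtension_coprod_inl (isDiscrete_sigma _))

/-- The subcomplex generated by a vertex. -/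
def vertexSubcomplex {B : SSet.{u}} (v : B _⦋0⦌) : B.Subcomplex where
  obj n := {constSimplex n v}
  map φ _ hb := by
    obtain rfl := hb
    exact map_constSimplex φ v

/-- The subcomplex generated by a vertex is isomorphic to `Δ[0]`. -/
noncomputable def vertexSubcomplexIso {B : SSet.{u}} (v : B _⦋0⦌) :
    (vertexSubcomplex v : SSet.{u}) ≅ Δ[0] := by
  let p : (Δ[0] : SSet.{u}) ⟶ (vertexSubcomplex v : SSet.{u}) :=
    SSet.Subcomplex.lift (SSet.const v) (by rintro n _ ⟨x, rfl⟩; rfl)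
  have : IsIso p := by
    rw [NatTrans.isIso_iff_isIso_app]
    intro n
    rw [isIso_iff_bijective]
    refine ⟨fun x y _ => SSet.stdSimplex.objEquiv.injective (Subsingleton.elim _ _), ?_⟩
    rintro ⟨x, rfl⟩
    exact ⟨constSimplex n (SSet.stdSimplex.obj₀Equiv.symm 0), rfl⟩
  exact (asIso p).symm

lemma po_homOfLE {B : SSet.{u}} {F G : B.Subcomplex} {v : B _⦋0⦌} (hFG : F ≤ G)
    (sup : F ⊔ vertexSubcomplex v = G) (inf : F ⊓ vertexSubcomplex v = ⊥) :
    Po emptyToPoint (SSet.Subcomplex.homOfLE hFG) := by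
  have sq : SSet.Subcomplex.BicartSq ⊥ (vertexSubcomplex v) F G :=
    { sup_eq := by rw [sup_comm, sup]
      inf_eq := by rw [inf_comm, inf] }
  refine ⟨_, _, _, _, _, ⟨?_⟩, sq.isPushout⟩
  exact Arrow.isoMk (SSet.Subcomplex.isInitialBot.uniqueUpToIso initialIsInitial)
    (vertexSubcomplexIso v) (SSet.Subcomplex.isInitialBot.hom_ext _ _)

section Filtration

variable {A B : SSet.{u}} (f : A ⟶ B)
  [LinearOrder {v : B _⦋0⦌ // v ∉ Set.range (f.app (op ⦋0⦌))}]

/-- The filtration of `B` obtained by adding to the image of `f : A ⟶ B` the vertices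
which are not in this image, one at a time. -/
def vertexFiltration (j : WithTop {v : B _⦋0⦌ // v ∉ Set.range (f.app (op ⦋0⦌))}) :
    B.Subcomplex where
  obj n := {b | b ∈ Set.range (f.app n) ∨ ∃ s, WithTop.some s < j ∧ constSimplex n s.1 = b}
  map φ _ hb := by
    obtain ⟨a, rfl⟩ | ⟨s, hs, rfl⟩ := hb
    · exact Or.inl ⟨A.map φ a, NatTrans.naturality_apply f φ a⟩
    · exact Or.inr ⟨s, hs, (map_constSimplex φ _).symm⟩

lemma vertexFiltration_monotone : Monotone (vertexFiltration f) := by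
  intro i j hij n b hb
  obtain hb | ⟨s, hs, rfl⟩ := hb
  · exact Or.inl hb
  · exact Or.inr ⟨s, hs.trans_le hij, rfl⟩

lemma vertexFiltration_bot
    [OrderBot (WithTop {v : B _⦋0⦌ // v ∉ Set.range (f.app (op ⦋0⦌))})] :
    vertexFiltration f ⊥ = SSet.Subcomplex.range f := by
  ext n b
  refine ⟨?_, Or.inl⟩
  rintro (h | ⟨s, hs, -⟩)
  · exact h
  · exact (not_lt_bot hs).elim

lemma isLUB_vertexFiltration_of_isSuccLimit
    {j : WithTop {v : B _⦋0⦌ // v ∉ Set.range (f.app (op ⦋0⦌))}} (hj : Order.IsSuccLimit j)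
    [SuccOrder (WithTop {v : B _⦋0⦌ // v ∉ Set.range (f.app (op ⦋0⦌))})] :
    IsLUB (Set.range fun i : {i // i < j} => vertexFiltration f i) (vertexFiltration f j) := by
  refine ⟨?_, fun F hF n b hb => ?_⟩
  · rintro _ ⟨i, rfl⟩
    exact vertexFiltration_monotone f i.2.le
  · obtain hb | ⟨s, hs, rfl⟩ := hb
    · obtain ⟨i, hi⟩ := not_isMin_iff.1 hj.not_isMin
      exact hF ⟨⟨i, hi⟩, rfl⟩ n (Or.inl hb)
    · refine hF ⟨⟨_, hj.succ_lt hs⟩, rfl⟩ n (Or.inr ⟨s, ?_, rfl⟩)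
      exact Order.lt_succ_of_not_isMax hs.not_isMax

end Filtration

namespace IsDiscreteExtension

variable {A B : SSet.{u}} {f : A ⟶ B}

lemma constSimplex_mem_range_iff (hf : IsDiscreteExtension f) (n : SimplexCategoryᵒᵖ)
    (v : B _⦋0⦌) : constSimplex n v ∈ Set.range (f.app n) ↔ v ∈ Set.range (f.app _) := by
  refine ⟨hf.mem_range_of_map _ _, ?_⟩
  rintro ⟨a, rfl⟩
  exact ⟨_, app_constSimplex _ _ _⟩

/-- The subcomplex of simplices which are not in the image of a discrete extension. -/
def complement (hf : IsDiscreteExtension f) : B.Subcomplex where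
  obj n := (Set.range (f.app n))ᶜ
  map φ _ hb h := hb (hf.mem_range_of_map φ _ h)

lemma isDiscrete_complement (hf : IsDiscreteExtension f) : IsDiscrete (hf.complement : SSet.{u}) := by
  rintro n ⟨b, hb⟩
  obtain ⟨v, rfl⟩ := hf.exists_vertex n b hb
  exact ⟨⟨v, fun h => hb ((hf.constSimplex_mem_range_iff n v).2 h)⟩, rfl⟩

lemma nonempty_isColimit_complement (hf : IsDiscreteExtension f) :
    Nonempty (IsColimit (BinaryCofan.mk f hf.complement.ι)) := by
  refine ⟨evaluationJointlyReflectsColimits _ fun n => ?_⟩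
  refine (isColimitMapCoconeBinaryCofanEquiv ((evaluation _ _).obj n) _ _).symm
    (Nonempty.some ?_)
  rw [Types.binaryCofan_isColimit_iff]
  refine ⟨hf.injective n, Subtype.val_injective, ?_⟩
  have : Set.range (hf.complement.ι.app n) = (Set.range (f.app n))ᶜ := Subtype.range_val
  exact this ▸ isCompl_compl

lemma vertexFiltration_top (hf : IsDiscreteExtension f)
    [LinearOrder {v : B _⦋0⦌ // v ∉ Set.range (f.app (op ⦋0⦌))}] :
    vertexFiltration f ⊤ = ⊤ := by
  ext n b
  refine ⟨fun _ => trivial, fun _ => ?_⟩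
  by_cases hb : b ∈ Set.range (f.app n)
  · exact Or.inl hb
  · obtain ⟨v, rfl⟩ := hf.exists_vertex n b hb
    exact Or.inr ⟨⟨v, fun hv => hb ((hf.constSimplex_mem_range_iff n v).2 hv)⟩,
      WithTop.coe_lt_top _, rfl⟩

lemma po_vertexFiltration (hf : IsDiscreteExtension f)
    [LinearOrder {v : B _⦋0⦌ // v ∉ Set.range (f.app (op ⦋0⦌))}]
    [SuccOrder (WithTop {v : B _⦋0⦌ // v ∉ Set.range (f.app (op ⦋0⦌))})]
    (j : WithTop {v : B _⦋0⦌ // v ∉ Set.range (f.app (op ⦋0⦌))}) (hj : ¬ IsMax j) :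
    Po emptyToPoint
      (SSet.Subcomplex.homOfLE (vertexFiltration_monotone f (Order.le_succ j))) := by
  induction j with
  | top => exact (hj isMax_top).elim
  | coe s =>
    refine po_homOfLE (v := s.1) _ ?_ ?_
    · ext n b
      constructor
      · rintro (hb | rfl)
        · exact vertexFiltration_monotone f (Order.le_succ _) n hb
        · exact Or.inr ⟨s, Order.lt_succ_of_not_isMax hj, rfl⟩
      · rintro (hb | ⟨t, ht, rfl⟩)
        · exact Or.inl (Or.inl hb)
        · obtain h | h := ((Order.lt_succ_iff_of_not_isMax hj).1 ht).lt_or_eq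
          · exact Or.inl (Or.inr ⟨t, h, rfl⟩)
          · obtain rfl := WithTop.coe_injective h
            exact Or.inr rfl
    · ext n b
      refine ⟨?_, fun h => h.elim⟩
      rintro ⟨hb | ⟨t, ht, hts⟩, rfl⟩
      · exact s.2 ((hf.constSimplex_mem_range_iff n _).1 hb)
      · obtain rfl : t = s := Subtype.ext (constSimplex_injective n hts)
        exact lt_irrefl _ ht

lemma isTransfiniteCompositionOf (hf : IsDiscreteExtension f) :
    IsTransfiniteCompositionOf.{u} (Po emptyToPoint) f := by
  let S := {v : B _⦋0⦌ // v ∉ Set.range (f.app (op ⦋0⦌))}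
  obtain ⟨_, _⟩ := exists_wellFoundedLT S
  let : SuccOrder (WithTop S) := SuccOrder.ofLinearWellFoundedLT _
  let : OrderBot (WithTop S) := WellFoundedLT.toOrderBot _
  have : Mono f := by
    have (n : SimplexCategoryᵒᵖ) : Mono (f.app n) := (mono_iff_injective _).2 (hf.injective n)
    exact NatTrans.mono_of_mono_app f
  let F := (vertexFiltration_monotone f).functor
  have hF : IsLUB (Set.range F.obj) ⊤ :=
    ⟨fun _ _ => le_top, fun G hG => (hf.vertexFiltration_top).symm.le.trans (hG ⟨⊤, rfl⟩)⟩
  refine ⟨WithTop S, inferInstance, inferInstance, inferInstance, inferInstance,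
    F ⋙ SSet.Subcomplex.toSSetFunctor, _,
    isColimitOfPreserves SSet.Subcomplex.toSSetFunctor
      (Preorder.colimitCoconeOfIsLUB F hF).isColimit,
    asIso (SSet.Subcomplex.toRange f) ≪≫
      SSet.Subcomplex.eqToIso (vertexFiltration_bot f).symm,
    SSet.Subcomplex.topIso B, fun j hj => hf.po_vertexFiltration j hj, fun j hj => ?_, ?_⟩
  · exact ⟨isColimitOfPreserves SSet.Subcomplex.toSSetFunctor
      (Preorder.isColimitOfIsLUB _ (coconeLT F j)
        (isLUB_vertexFiltration_of_isSuccLimit f hj))⟩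
  · rfl

end IsDiscreteExtension

end DiscreteExtension

open Simplicial in
/-- in simplicial sets, a morphism lies in `cof({t})`, for
`t : ∅ ⟶ Δ[0]`, iff it is isomorphic in the arrow category to a coproduct injection
`X ⟶ X ⨿ D` with `D` a discrete simplicial set (a coproduct of copies of `Δ[0]`). -/
theorem cof_initial_to_point {A B : SSet.{0}} (f : A ⟶ B) :
    cofClosure (ofFamily (fun _ : PUnit =>
      (initial.to Δ[0] : (⊥_ SSet.{0}) ⟶ Δ[0]))) f ↔
    ∃ (X D : SSet.{0}) (S : Type) (_ : D ≅ ∐ fun _ : S => (Δ[0] : SSet.{0})),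
      Nonempty (Arrow.mk f ≅ Arrow.mk (coprod.inl : X ⟶ X ⨿ D)) := by
  rw [ofFamily_emptyToPoint]
  refine ⟨fun hf => ?_, ?_⟩
  · replace hf := isDiscreteExtension_of_cofClosure hf
    obtain ⟨hc⟩ := hf.nonempty_isColimit_complement
    exact ⟨A, hf.complement, _,
      hf.isDiscrete_complement.isColimit.coconePointUniqueUpToIso (coproductIsCoproduct _),
      ⟨Arrow.isoMk (Iso.refl A) (hc.coconePointUniqueUpToIso (colimit.isColimit _))
        ((id_comp _).trans
          (hc.comp_coconePointUniqueUpToIso_hom (colimit.isColimit _) ⟨.left⟩).symm)⟩⟩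
  · rintro ⟨X, D, S, e, ⟨i⟩⟩
    have hf : IsDiscreteExtension f := IsRetractOf.isDiscreteExtension
      ⟨i.hom.left, i.hom.right, i.inv.left, i.inv.right, i.hom.w, i.inv.w,
        congrArg CommaMorphism.left i.hom_inv_id, congrArg CommaMorphism.right i.hom_inv_id⟩
      (isDiscreteExtension_coprod_inl ((isDiscrete_sigma S).of_iso e))
    exact ⟨A, B, f, hf.isTransfiniteCompositionOf, 𝟙 A, 𝟙 B, 𝟙 A, 𝟙 B, by simp⟩

end CellularPaper
end
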